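/- For every g ≥ 3, the general linear group GL_g(ℤ) of invertible g×g integer matrices is rationally perfect: H¹(GL_g(ℤ); V) = 0 for every finite-dimensional rational representation V of GL_g(ℤ). -/

import Mathlib

/-- A group `G` is *rationally perfect* if `H¹(G; V) = 0` for every
finite-dimensional rational representation `V` of `G`. -/
def RationallyPerfect (G : Type) [Group G] : Prop :=
  ∀ (V : Type) [AddCommGroup V] [Module ℚ V] [FiniteDimensional ℚ V]
    (ρ : Representation ℚ G V),
      Subsingleton (groupCohomology.H1 (Rep.of ρ))


section Part1
namespace RP
open Matrix
variable {n : ℕ}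
abbrev S (n : ℕ) := Matrix.SpecialLinearGroup (Fin n) ℤ
abbrev x {i j : Fin n} (h : i ≠ j) (c : ℤ) : S n := SpecialLinearGroup.transvection h c

lemma mulE (A B : S n) (i j : Fin n) : (A * B) i j = ((A : Matrix (Fin n) (Fin n) ℤ) * (B : Matrix (Fin n) (Fin n) ℤ)) i j := rfl

lemma x_apply {i j : Fin n} (h : i ≠ j) (c : ℤ) (k l : Fin n) :
    (x h c : S n) k l = (1 : Matrix (Fin n) (Fin n) ℤ) k l + if k = i ∧ l = j then c else 0 := by
  simp only [SpecialLinearGroup.transvection_coe, Matrix.add_apply, Matrix.single_apply]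
  congr 1
  simp [eq_comm]

lemma x_mul_apply {i j : Fin n} (h : i ≠ j) (c : ℤ) (g : S n) (k l : Fin n) :
    (x h c * g : S n) k l = g k l + if k = i then c * g j l else 0 := by
  rw [mulE]
  simp only [SpecialLinearGroup.transvection_coe, add_mul, one_mul,
    Matrix.add_apply]
  congr 1
  split_ifs with hk
  · subst hk; simp
  · simp [Matrix.single_mul_apply_of_ne, hk]

lemma mul_x_apply {i j : Fin n} (h : i ≠ j) (c : ℤ) (g : S n) (k l : Fin n) :
    (g * x h c : S n) k l = g k l + if l = j then g k i * c else 0 := by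
  rw [mulE]
  simp only [SpecialLinearGroup.transvection_coe, mul_add, mul_one,
    Matrix.add_apply]
  congr 1
  split_ifs with hk
  · subst hk; simp
  · simp [Matrix.mul_single_apply_of_ne, hk]

lemma x_pow {i j : Fin n} (h : i ≠ j) (c : ℤ) (m : ℕ) : (x h c) ^ m = x h (m * c) := by
  induction m with
  | zero => simp [x]
  | succ k ih => rw [pow_succ, ih, x, x, x, ← SpecialLinearGroup.transvection_add]; push_cast; ring_nf

lemma x_zpow {i j : Fin n} (h : i ≠ j) (c : ℤ) (m : ℤ) : (x h c) ^ m = x h (m * c) := by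
  obtain ⟨k, rfl | rfl⟩ := m.eq_nat_or_neg
  · simpa using x_pow h c k
  · rw [_root_.zpow_neg, zpow_natCast, x_pow, x, x, SpecialLinearGroup.transvection_inv]; push_cast; ring_nf

lemma x_rel {i j k : Fin n} (hij : i ≠ j) (hjk : j ≠ k) (hik : i ≠ k) (a b : ℤ) :
    x hij a * x hjk b = x hik (a * b) * (x hjk b * x hij a) := by
  ext p q
  simp only [x_mul_apply, x_apply, Matrix.one_apply]
  by_cases h1 : p = i <;> by_cases h2 : p = j <;> by_cases h3 : q = j <;> by_cases h4 : q = k <;>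
    subst_vars <;> simp_all [eq_comm] 

lemma x_comm {i j k l : Fin n} (hij : i ≠ j) (hkl : k ≠ l) (hjk : j ≠ k) (hil : i ≠ l) (a b : ℤ) :
    x hij a * x hkl b = x hkl b * x hij a := by
  ext p q
  simp only [x_mul_apply, x_apply, Matrix.one_apply]
  by_cases h1 : p = i <;> by_cases h2 : p = k <;> by_cases h3 : q = j <;> by_cases h4 : q = l <;>
    subst_vars <;> simp_all [eq_comm, add_comm]

/-- row matrices -/
lemma rowEx (M : Subgroup (S n)) (a : Fin n) (r : Fin n → ℤ)
    (hM : ∀ j (h : a ≠ j), x h (r j) ∈ M) :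
    ∃ A ∈ M, ∀ i j, A i j = (1 : Matrix (Fin n) (Fin n) ℤ) i j + if i = a ∧ j ≠ a then r j else 0 := by
  have key : ∀ u : Finset (Fin n), a ∉ u → ∃ A ∈ M, ∀ i j, A i j =
      (1 : Matrix (Fin n) (Fin n) ℤ) i j + if i = a ∧ j ∈ u then r j else 0 := by
    intro u
    induction u using Finset.induction_on with
    | empty => intro _; exact ⟨1, M.one_mem, by simp⟩
    | insert b u hb ih =>
      intro ha
      obtain ⟨A, hA, hA'⟩ := ih (by simp_all)
      have hab : a ≠ b := by rintro rfl; simp at ha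
      refine ⟨x hab (r b) * A, M.mul_mem (hM b hab) hA, fun i j => ?_⟩
      rw [x_mul_apply, hA', hA']
      by_cases h1 : i = a <;> by_cases h2 : j = b <;> subst_vars <;>
        simp_all [Matrix.one_apply, eq_comm] 
  obtain ⟨A, hA, hA'⟩ := key (Finset.univ.erase a) (by simp)
  exact ⟨A, hA, fun i j => by simpa using hA' i j⟩

lemma colEx (M : Subgroup (S n)) (a : Fin n) (r : Fin n → ℤ)
    (hM : ∀ j (h : j ≠ a), x h (r j) ∈ M) :
    ∃ A ∈ M, ∀ i j, A i j = (1 : Matrix (Fin n) (Fin n) ℤ) i j + if j = a ∧ i ≠ a then r i else 0 := by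
  have key : ∀ u : Finset (Fin n), a ∉ u → ∃ A ∈ M, ∀ i j, A i j =
      (1 : Matrix (Fin n) (Fin n) ℤ) i j + if j = a ∧ i ∈ u then r i else 0 := by
    intro u
    induction u using Finset.induction_on with
    | empty => intro _; exact ⟨1, M.one_mem, by simp⟩
    | insert b u hb ih =>
      intro ha
      obtain ⟨A, hA, hA'⟩ := ih (by simp_all)
      have hab : b ≠ a := by rintro rfl; simp at ha
      refine ⟨A * x hab (r b), M.mul_mem hA (hM b hab), fun i j => ?_⟩
      rw [mul_x_apply, hA', hA']
      by_cases h1 : i = b <;> by_cases h2 : j = a <;> subst_vars <;>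
        simp_all [Matrix.one_apply, eq_comm] 
  obtain ⟨A, hA, hA'⟩ := key (Finset.univ.erase a) (by simp)
  exact ⟨A, hA, fun i j => by simpa using hA' i j⟩

lemma rowA_mul {a : Fin n} {r : Fin n → ℤ} {A : S n}
    (hA : ∀ i j, A i j = (1 : Matrix (Fin n) (Fin n) ℤ) i j + if i = a ∧ j ≠ a then r j else 0)
    (g : S n) (i j : Fin n) : (A * g) i j = g i j + if i = a then ∑ k ∈ Finset.univ.erase a, r k * g k j else 0 := by
  rw [mulE, Matrix.mul_apply]
  simp only [hA, add_mul, Finset.sum_add_distrib]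
  rw [← Matrix.mul_apply, one_mul]
  congr 1
  split_ifs with h
  · rw [← Finset.sum_erase (a := a) Finset.univ (by simp)]
    refine Finset.sum_congr rfl fun k hk => ?_
    simp_all
  · simp [h]

lemma mul_rowA {a : Fin n} {r : Fin n → ℤ} {A : S n}
    (hA : ∀ i j, A i j = (1 : Matrix (Fin n) (Fin n) ℤ) i j + if i = a ∧ j ≠ a then r j else 0)
    (g : S n) (i j : Fin n) : (g * A) i j = g i j + if j ≠ a then g i a * r j else 0 := by
  rw [mulE, Matrix.mul_apply]
  simp only [hA, mul_add, Finset.sum_add_distrib]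
  rw [← Matrix.mul_apply, mul_one]
  congr 1
  rw [Finset.sum_eq_single a] <;> simp +contextual

lemma colA_mul {a : Fin n} {r : Fin n → ℤ} {A : S n}
    (hA : ∀ i j, A i j = (1 : Matrix (Fin n) (Fin n) ℤ) i j + if j = a ∧ i ≠ a then r i else 0)
    (g : S n) (i j : Fin n) : (A * g) i j = g i j + if i ≠ a then r i * g a j else 0 := by
  rw [mulE, Matrix.mul_apply]
  simp only [hA, add_mul, Finset.sum_add_distrib]
  rw [← Matrix.mul_apply, one_mul]
  congr 1
  rw [Finset.sum_eq_single a] <;> simp +contextual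

lemma mul_colA {a : Fin n} {r : Fin n → ℤ} {A : S n}
    (hA : ∀ i j, A i j = (1 : Matrix (Fin n) (Fin n) ℤ) i j + if j = a ∧ i ≠ a then r i else 0)
    (g : S n) (i j : Fin n) : (g * A) i j = g i j + if j = a then ∑ k ∈ Finset.univ.erase a, g i k * r k else 0 := by
  rw [mulE, Matrix.mul_apply]
  simp only [hA, mul_add, Finset.sum_add_distrib]
  rw [← Matrix.mul_apply, mul_one]
  congr 1
  split_ifs with h
  · rw [← Finset.sum_erase (a := a) Finset.univ (by simp)]
    refine Finset.sum_congr rfl fun k hk => ?_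
    simp_all
  · simp [h]
end RP
end Part1

section Part2
namespace RP
open Matrix
variable {n : ℕ}

def El (n : ℕ) : Subgroup (S n) := Subgroup.closure {g | ∃ (i j : Fin n) (h : i ≠ j) (c : ℤ), g = x h c}

lemma x_mem {i j : Fin n} (h : i ≠ j) (c : ℤ) : x h c ∈ El n :=
  Subgroup.subset_closure ⟨i, j, h, c, rfl⟩

def Pr (s : Finset (Fin n)) (g : S n) : Prop :=
  ∀ i, i ∉ s → ∀ j, g i j = (1 : Matrix (Fin n) (Fin n) ℤ) i j ∧ g j i = (1 : Matrix (Fin n) (Fin n) ℤ) j i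

lemma Pr_x_mul {s : Finset (Fin n)} {g : S n} (hg : Pr s g) {i j : Fin n} (h : i ≠ j) (hi : i ∈ s)
    (hj : j ∈ s) (c : ℤ) : Pr s (x h c * g) := by
  intro k hk l
  have h1 : k ≠ i := by rintro rfl; exact hk hi
  have h2 : k ≠ j := by rintro rfl; exact hk hj
  rw [x_mul_apply, x_mul_apply, (hg k hk l).1, (hg k hk l).2, (hg k hk j).2]
  simp [h1, h2.symm]

lemma col_unit (g : S n) (a i : Fin n) (h : ∀ k, k ≠ i → g k a = 0) : IsUnit (g i a) := by
  have := congrFun (congrFun (congrArg (fun m : S n => (m : Matrix (Fin n) (Fin n) ℤ)) (inv_mul_cancel g)) a) a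
  change ((g⁻¹ : S n) * g) a a = (1 : Matrix (Fin n) (Fin n) ℤ) a a at this
  rw [mulE, Matrix.mul_apply, Finset.sum_eq_single i] at this
  · simp only [Matrix.one_apply_eq] at this
    exact IsUnit.of_mul_eq_one_right _ this
  · intro b _ hb
    simp [h b hb]
  · simp

lemma red_col {s : Finset (Fin n)} {a : Fin n} (ha : a ∈ s) (g : S n) (hg : Pr s g) :
    ∃ e ∈ El n, Pr s (e * g) ∧ ∃ i ∈ s, ∀ k, k ≠ i → (e * g) k a = 0 := by
  have hne : ∃ m : ℕ, ∃ e ∈ El n, Pr s (e * g) ∧ ∑ k, ((e * g) k a).natAbs = m :=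
    ⟨_, 1, (El n).one_mem, by simpa using hg, rfl⟩
  classical
  obtain ⟨e, he, hP, hs⟩ := Nat.find_spec hne
  have hmin := fun m hm => Nat.find_min hne (m := m) hm
  refine ⟨e, he, hP, ?_⟩
  have key : ∀ i ∈ s, ∀ j ∈ s, i ≠ j → (e * g) i a ≠ 0 → (e * g) j a ≠ 0 →
      ((e * g) i a).natAbs ≤ ((e * g) j a).natAbs → False := by
    intro i hi j hj hij h1 h2 h3
    obtain ⟨c, hc⟩ : ∃ c : ℤ, ((e * g) j a + c * (e * g) i a).natAbs < ((e * g) j a).natAbs := by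
      generalize (e * g) i a = p at *
      generalize (e * g) j a = q at *
      rcases le_or_gt 0 p with hp | hp <;> rcases le_or_gt 0 q with hq | hq
      · exact ⟨-1, by omega⟩
      · exact ⟨1, by omega⟩
      · exact ⟨1, by omega⟩
      · exact ⟨-1, by omega⟩
    refine hmin _ ?_ ⟨x hij.symm c * e, (El n).mul_mem (x_mem _ _) he, ?_, rfl⟩
    · rw [← hs, mul_assoc]
      refine Finset.sum_lt_sum (fun k _ => ?_) ⟨j, Finset.mem_univ _, ?_⟩
      · rw [x_mul_apply]
        split_ifs with h
        · subst h; exact hc.le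
        · simp
      · rw [x_mul_apply]
        simpa using hc
    · rw [mul_assoc]
      exact Pr_x_mul hP _ hj hi _
  have hz : ∀ k, k ∉ s → (e * g) k a = 0 := by
    intro k hk
    rw [(hP k hk a).1, Matrix.one_apply_ne]
    rintro rfl; exact hk ha
  by_cases hall : ∀ k, (e * g) k a = 0
  · exact ⟨a, ha, fun k _ => hall k⟩
  · push Not at hall
    obtain ⟨i, hi⟩ := hall
    have his : i ∈ s := by by_contra h; exact hi (hz i h)
    refine ⟨i, his, fun k hk => ?_⟩
    by_contra hk0
    have hks : k ∈ s := by by_contra h; exact hk0 (hz k h)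
    rcases le_total ((e * g) i a).natAbs ((e * g) k a).natAbs with h | h
    · exact key i his k hks hk.symm hi hk0 h
    · exact key k hks i his hk hk0 hi h

lemma red_col2 {s : Finset (Fin n)} {a : Fin n} (ha : a ∈ s) (g : S n) (hg : Pr s g)  :
    ∃ e ∈ El n, Pr s (e * g) ∧ ∀ k, (e * g) k a = (1 : Matrix (Fin n) (Fin n) ℤ) k a := by
  obtain ⟨e, he, hP, i, hi, hk⟩ := red_col ha g hg
  have hu := Int.isUnit_iff.1 (col_unit (e * g) a i hk)
  by_cases hia : i = a
  · subst hia
    rcases hu with hu | hu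
    · refine ⟨e, he, hP, fun k => ?_⟩
      by_cases h : k = i
      · subst h; simp [hu]
      · rw [hk k h, Matrix.one_apply_ne h]
    · by_cases hb : ∃ b ∈ s, b ≠ i
      · obtain ⟨b, hb, hbi⟩ := hb
        refine ⟨x hbi 1 * (x hbi.symm (-2) * (x hbi 1 * e)), ?_, ?_, ?_⟩
        · exact mul_mem (x_mem _ _) (mul_mem (x_mem _ _) (mul_mem (x_mem _ _) he))
        · simp only [mul_assoc]
          exact Pr_x_mul (Pr_x_mul (Pr_x_mul hP _ hb hi _) _ hi hb _) _ hb hi _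
        · intro k
          simp only [mul_assoc, x_mul_apply]
          have := hk b hbi
          by_cases h1 : k = i
          · subst h1; simp [hbi.symm, hu, this]
          · by_cases h2 : k = b
            · subst h2; simp [hu, this, hbi, hbi.symm]
            · simp [h1, h2, hk k h1]
      · exfalso
        push Not at hb
        have hd : ((e * g : S n) : Matrix (Fin n) (Fin n) ℤ) = Matrix.diagonal (fun k => if k = i then -1 else 1) := by
          ext p q
          by_cases hp : p = i
          · by_cases hq : q = i
            · subst hp; subst hq; simpa using hu
            · rw [(hP q (fun h => hq (hb q h)) p).2]
              simp [hp, Ne.symm hq, Matrix.one_apply, Matrix.diagonal_apply]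
          · rw [(hP p (fun h => hp (hb p h)) q).1]
            simp [Matrix.one_apply, Matrix.diagonal_apply, hp]
        have h1 := (e * g).2
        rw [hd, Matrix.det_diagonal] at h1
        simp [Finset.prod_ite_eq'] at h1
  · obtain ⟨m, hm⟩ : ∃ m, m = e * g := ⟨_, rfl⟩
    rw [← hm] at hP hk hu
    have hc : m i a * m i a = 1 := by rcases hu with h | h <;> simp [h]
    have hia' : a ≠ i := Ne.symm hia
    refine ⟨x hia (-m i a) * (x hia' (m i a) * e), ?_, ?_, ?_⟩
    · exact mul_mem (x_mem _ _) (mul_mem (x_mem _ _) he)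
    · simp only [mul_assoc, ← hm]
      exact Pr_x_mul (Pr_x_mul hP _ ha hi _) _ hi ha _
    · intro k
      simp only [mul_assoc, ← hm, x_mul_apply]
      have := hk a hia'
      by_cases h1 : k = i
      · subst h1; simp [this, hc, hia]
      · by_cases h2 : k = a
        · subst h2; simp [this, hc, hia']
        · simp [h1, h2, hk k h1]

lemma gen_aux (s : Finset (Fin n)) : ∀ g : S n, Pr s g → g ∈ El n := by
  induction s using Finset.induction_on with
  | empty =>
    intro g hg
    have : g = 1 := by
      ext i j; exact (hg i (by simp) j).1
    rw [this]; exact one_mem _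
  | insert a t hat ih =>
    intro g hg
    obtain ⟨e, he, hP, hc⟩ := red_col2 (Finset.mem_insert_self a t) g hg
    obtain ⟨A, hA, hA'⟩ := rowEx (El n) a (fun j => -(e * g) a j) (fun j h => x_mem _ _)
    have : e * g * A ∈ El n := by
      apply ih
      intro i hi j
      rw [mul_rowA hA', mul_rowA hA', hc, hc]
      by_cases hia : i = a
      · subst hia
        by_cases hj : j = i
        · subst hj; simp [hc]
        · simp [hj, hc, Matrix.one_apply_ne, Ne.symm hj]
      · have hi' : i ∉ insert a t := by simp [hia, hi]
        rw [(hP i hi' j).1, (hP i hi' j).2, (hP i hi' a).2, Matrix.one_apply_ne hia]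
        refine ⟨by simp, ?_⟩
        simp only [Matrix.one_apply, Ne.symm hia]
        simp
    have h2 := mul_mem (mul_mem (inv_mem he) this) (inv_mem hA)
    simpa [mul_assoc] using h2

lemma El_eq_top : El n = ⊤ := by
  rw [eq_top_iff]
  intro g _
  exact gen_aux Finset.univ g (fun i hi => by simp at hi)
end RP
end Part2

section Part3
namespace RP
open Matrix
variable {n : ℕ}

def Cg (N : ℕ) (g : S n) : Prop := ∀ i j, (N : ℤ) ∣ g i j - (1 : Matrix (Fin n) (Fin n) ℤ) i j

lemma exists_t (va vb : ℤ) (hva : va ≠ 0) :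
    ∃ t : ℤ, ∀ p : ℤ, Prime p → p ∣ va → (p ∣ t ↔ ¬ p ∣ vb) := by
  classical
  refine ⟨∏ q ∈ (va.natAbs.primeFactors.filter (fun q : ℕ => ¬ ((q : ℤ) ∣ vb)) : Finset ℕ), (q : ℤ), fun p hp hpa => ?_⟩
  rw [hp.dvd_finsetProd_iff]
  constructor
  · rintro ⟨q, hq, hpq⟩ hb
    simp only [Finset.mem_filter, Nat.mem_primeFactors] at hq
    have hq' : Prime (q : ℤ) := Nat.prime_iff_prime_int.1 hq.1.1
    have := (hp.associated_of_dvd hq' hpq).dvd_iff_dvd_left (c := vb)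
    exact hq.2 (this.1 hb)
  · intro h
    refine ⟨p.natAbs, ?_, by simp [Int.dvd_natAbs]⟩
    simp only [Finset.mem_filter, Nat.mem_primeFactors]
    refine ⟨⟨Int.prime_iff_natAbs_prime.1 hp, Int.natAbs_dvd_natAbs.2 hpa, by simpa using hva⟩, ?_⟩
    rwa [Int.natAbs_dvd]

lemma not_dvd_col (g : S n) (a : Fin n) (p : ℤ) (hp : Prime p) : ¬ ∀ i, p ∣ g i a := by
  intro h
  have := congrFun (congrFun (congrArg (fun m : S n => (m : Matrix (Fin n) (Fin n) ℤ)) (inv_mul_cancel g)) a) a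
  change ((g⁻¹ : S n) * g) a a = (1 : Matrix (Fin n) (Fin n) ℤ) a a at this
  rw [mulE, Matrix.mul_apply, Matrix.one_apply_eq] at this
  apply hp.not_isUnit
  rw [isUnit_iff_dvd_one, ← this]
  exact Finset.dvd_sum fun i _ => Dvd.dvd.mul_left (h i) _

lemma x_inv {i j : Fin n} (h : i ≠ j) (c : ℤ) : (x h c)⁻¹ = x h (-c) :=
  SpecialLinearGroup.transvection_inv h c

lemma colprep {N : ℕ} (hN : 2 ≤ N) (K : Subgroup (S n)) [K.Normal]
    (hK : ∀ (i j : Fin n) (h : i ≠ j), x h N ∈ K) {a b c : Fin n} (hab : a ≠ b) (hac : a ≠ c)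
    (hbc : b ≠ c) (g : S n) (hg : Cg N g) :
    ∃ k ∈ K, ∀ i, (k * g) i a = (1 : Matrix (Fin n) (Fin n) ℤ) i a := by
  have hK' : ∀ (i j : Fin n) (h : i ≠ j) (m : ℤ), x h (m * N) ∈ K := by
    intro i j h m
    rw [← x_zpow]; exact K.zpow_mem (hK i j h) m
  have hK'' : ∀ (i j : Fin n) (h : i ≠ j) (m : ℤ), (N : ℤ) ∣ m → x h m ∈ K := by
    rintro i j h m ⟨q, rfl⟩
    rw [mul_comm]; exact hK' i j h q
  have hN1 : ¬ (N : ℤ) ∣ 1 := by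
    intro h
    have := Int.le_of_dvd one_pos h
    omega
  have hva : g a a ≠ 0 := by
    intro h
    have := hg a a
    rw [h, Matrix.one_apply_eq] at this
    simp at this
    omega
  obtain ⟨t, ht⟩ := exists_t (g a a) (g b a) hva
  set g1 := x hbc (t * N) * g with hg1
  have hg1a : ∀ i, i ≠ b → g1 i a = g i a := by
    intro i hi; rw [hg1, x_mul_apply]; simp [hi]
  have hg1b : g1 b a = g b a + t * N * g c a := by
    rw [hg1, x_mul_apply]; simp
  let w : Fin n → ℤ := fun i => if i = c then 0 else g1 i a
  have hw : Ideal.span (Set.range w) = ⊤ := by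
    by_contra hne
    obtain ⟨P, hP, hle⟩ := Ideal.exists_le_maximal _ hne
    obtain ⟨p, rfl⟩ : ∃ p, P = Ideal.span {p} := (IsPrincipalIdealRing.principal P).principal
    have hwp : ∀ i, p ∣ w i := fun i =>
      Ideal.mem_span_singleton.1 (hle (Ideal.subset_span ⟨i, rfl⟩))
    have hp0 : p ≠ 0 := by
      rintro rfl
      have := hwp a
      simp [w, hac, hg1a a hab, hva] at this
    have hp : Prime p := (Ideal.span_singleton_prime hp0).1 hP.isPrime
    have hpi : ∀ i, i ≠ b → i ≠ c → p ∣ g i a := by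
      intro i h1 h2
      have := hwp i
      simpa [w, h2, hg1a i h1] using this
    have hpb : p ∣ g b a + t * N * g c a := by
      have := hwp b
      simpa [w, hbc, hg1b] using this
    have hpa := hpi a hab hac
    have htp := ht p hp hpa
    by_cases h : p ∣ g b a
    · have h2 : p ∣ t * N * g c a := (dvd_add_right h).1 hpb
      rcases hp.dvd_or_dvd h2 with h3 | h3
      · rcases hp.dvd_or_dvd h3 with h4 | h4
        · exact htp.1 h4 h
        · have h5 := hg a a
          rw [Matrix.one_apply_eq] at h5
          have h6 := dvd_sub hpa (h4.trans h5)
          simp only [sub_sub_cancel] at h6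
          exact hp.not_isUnit (isUnit_of_dvd_one h6)
      · refine not_dvd_col g a p hp fun i => ?_
        by_cases hib : i = b
        · subst hib; exact h
        · by_cases hic : i = c
          · subst hic; exact h3
          · exact hpi i hib hic
    · have h3 := htp.2 h
      exact h ((dvd_add_left (Dvd.dvd.mul_right (Dvd.dvd.mul_right h3 _) _)).1 hpb)
  have h1 : (1 : ℤ) ∈ Ideal.span (Set.range w) := by rw [hw]; trivial
  obtain ⟨s, hs⟩ := (Ideal.mem_span_range_iff_exists_fun).1 h1
  have hs' : ∑ i ∈ Finset.univ.erase c, s i * g1 i a = 1 := by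
    refine Eq.trans ?_ hs
    rw [← Finset.sum_erase (a := c) Finset.univ (by simp [w])]
    refine Finset.sum_congr rfl fun i hi => ?_
    simp at hi
    simp [w, hi]
  have hd : (N : ℤ) ∣ 1 - g a a - g c a := by
    have h1 := hg a a
    have h2 := hg c a
    rw [Matrix.one_apply_eq] at h1
    rw [Matrix.one_apply_ne hac.symm] at h2
    obtain ⟨u, hu⟩ := h1
    obtain ⟨v, hv⟩ := h2
    exact ⟨-(u + v), by linarith⟩
  obtain ⟨q, hq⟩ := hd
  obtain ⟨A, hA, hA'⟩ := rowEx K c (fun j => (q * s j) * N) (fun j h => hK' _ _ _ _)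
  have hg2 : ∀ i, (A * g1) i a = g1 i a + if i = c then N * q else 0 := by
    intro i
    rw [rowA_mul hA']
    congr 1
    split_ifs with h
    · have : ∀ k, q * s k * N * g1 k a = N * q * (s k * g1 k a) := fun k => by ring
      simp only [this]
      rw [← Finset.mul_sum, hs', mul_one]
    · rfl
  set g2 := x hac 1 * (A * g1) with hg2d
  have hg2i : ∀ i, i ≠ a → g2 i a = g1 i a + if i = c then N * q else 0 := by
    intro i hi; rw [hg2d, x_mul_apply, hg2]; simp [hi]
  have hg2a : g2 a a = 1 := by
    rw [hg2d, x_mul_apply, hg2, hg2, hg1a a hab, hg1a c hbc.symm]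
    simp [hac]
    linarith
  have hdv : ∀ j, j ≠ a → (N : ℤ) ∣ g2 j a := by
    intro j hj
    have hgj : ∀ j, j ≠ a → (N : ℤ) ∣ g j a := by
      intro j hj
      have := hg j a
      rwa [Matrix.one_apply_ne hj, sub_zero] at this
    rw [hg2i j hj]
    refine dvd_add ?_ ?_
    · by_cases hjb : j = b
      · subst hjb; rw [hg1b]
        exact dvd_add (hgj _ hj) (Dvd.dvd.mul_left (hgj _ hac.symm) _)
      · rw [hg1a j hjb]; exact hgj j hj
    · split_ifs <;> simp
  obtain ⟨B, hB, hB'⟩ := colEx K a (fun j => - g2 j a) (fun j h => hK'' _ _ _ _ (dvd_neg.2 (hdv j h)))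
  have hfin : ∀ i, (B * g2) i a = (1 : Matrix (Fin n) (Fin n) ℤ) i a := by
    intro i
    rw [colA_mul hB', hg2a]
    by_cases h : i = a
    · subst h; simp [hg2a]
    · simp [h]
  refine ⟨x hac (-1) * B * x hac 1 * A * x hbc (t * N), ?_, ?_⟩
  · refine mul_mem (mul_mem ?_ hA) (hK' _ _ _ _)
    have := ‹K.Normal›.conj_mem B hB (x hac (-1))
    rwa [x_inv, neg_neg] at this
  · intro i
    have : x hac (-1) * B * x hac 1 * A * x hbc (t * N) * g = x hac (-1) * (B * g2) := by
      simp only [hg2d, hg1, mul_assoc]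
    rw [this, x_mul_apply, hfin, hfin]
    simp [hac.symm]

lemma Cg_mem {N : ℕ} (g : S n) :
    g ∈ (SpecialLinearGroup.map (n := Fin n) (Int.castRingHom (ZMod N))).ker ↔ Cg N g := by
  rw [MonoidHom.mem_ker]
  constructor
  · intro h i j
    have := congrFun (congrFun (congrArg (fun m : SpecialLinearGroup (Fin n) (ZMod N) => (m : Matrix (Fin n) (Fin n) (ZMod N))) h) i) j
    rw [← ZMod.intCast_zmod_eq_zero_iff_dvd] 
    simp [SpecialLinearGroup.map_apply_coe, RingHom.mapMatrix_apply, Matrix.map_apply, Matrix.one_apply] at this ⊢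
    rw [this]; simp
  · intro h
    ext i j
    have := h i j
    rw [← ZMod.intCast_zmod_eq_zero_iff_dvd] at this
    simp [SpecialLinearGroup.map_apply_coe, RingHom.mapMatrix_apply, Matrix.map_apply, Matrix.one_apply, sub_eq_zero] at this ⊢
    rw [this]
end RP
end Part3

section Part4
namespace RP
open Matrix
variable {n : ℕ}

lemma comm_mod {N : ℕ} (hN : 2 ≤ N) (K : Subgroup (S n)) [K.Normal]
    (hK : ∀ (i j : Fin n) (h : i ≠ j), x h N ∈ K) (hKN : ∀ k ∈ K, Cg N k) (hn : 3 ≤ n)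
    (g : S n) (hg : Cg N g) : (QuotientGroup.mk g : S n ⧸ K) ∈ Subgroup.center (S n ⧸ K) := by
  have hK'' : ∀ (i j : Fin n) (h : i ≠ j) (m : ℤ), (N : ℤ) ∣ m → x h m ∈ K := by
    rintro i j h m ⟨q, rfl⟩
    rw [mul_comm, ← x_zpow]; exact K.zpow_mem (hK i j h) q
  have hmul : ∀ p q : S n, Cg N p → Cg N q → Cg N (p * q) := by
    intro p q hp hq
    rw [← Cg_mem] at *; exact mul_mem hp hq
  have hinv : ∀ p : S n, Cg N p → Cg N p⁻¹ := by
    intro p hp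
    rw [← Cg_mem] at *; exact inv_mem hp
  obtain ⟨a, b, c, hab, hac, hbc⟩ : ∃ a b c : Fin n, a ≠ b ∧ a ≠ c ∧ b ≠ c :=
    ⟨⟨0, by omega⟩, ⟨1, by omega⟩, ⟨2, by omega⟩, by simp, by simp, by simp⟩
  obtain ⟨k, hk, hcol⟩ := colprep hN K hK hab hac hbc g hg
  have hg1 : Cg N (k * g) := hmul _ _ (hKN k hk) hg
  obtain ⟨C, hC, hC'⟩ := rowEx K a (fun j => - (k * g) a j) (fun j h => hK'' _ _ _ _ (by
    have := hg1 a j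
    rw [Matrix.one_apply_ne h, sub_zero] at this
    exact dvd_neg.2 this))
  obtain ⟨g2, hg2⟩ : ∃ g2, g2 = k * g * C := ⟨_, rfl⟩
  have hgg : (QuotientGroup.mk g : S n ⧸ K) = QuotientGroup.mk g2 := by
    rw [hg2, QuotientGroup.mk_mul, QuotientGroup.mk_mul, (QuotientGroup.eq_one_iff k).2 hk,
      (QuotientGroup.eq_one_iff C).2 hC]
    simp
  have hcg : Cg N g2 := by rw [hg2]; exact hmul _ _ hg1 (hKN C hC)
  have hc2 : ∀ i, g2 i a = (1 : Matrix (Fin n) (Fin n) ℤ) i a := by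
    intro i
    rw [hg2, mul_rowA hC', hcol]; simp
  have hr2 : ∀ j, g2 a j = (1 : Matrix (Fin n) (Fin n) ℤ) a j := by
    intro j
    by_cases h : j = a
    · subst h; exact hc2 _
    · rw [hg2, mul_rowA hC', hcol]; simp [h, Ne.symm h, Matrix.one_apply]
  have hii : ∀ p q, ∑ k, g2⁻¹ p k * g2 k q = (1 : Matrix (Fin n) (Fin n) ℤ) p q := by
    intro p q
    rw [← Matrix.mul_apply, ← mulE, inv_mul_cancel]; rfl
  have hic : ∀ j, g2⁻¹ j a = (1 : Matrix (Fin n) (Fin n) ℤ) j a := by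
    intro j
    rw [← hii j a, Finset.sum_eq_single a]
    · simp [hc2]
    · intro k _ hk; simp [hc2, hk]
    · simp
  have R1 : ∀ j (h : a ≠ j), (QuotientGroup.mk g2 : S n ⧸ K) * QuotientGroup.mk (x h 1) = QuotientGroup.mk (x h 1) * QuotientGroup.mk g2 := by
    intro j h
    obtain ⟨A, hA, hA'⟩ := rowEx K a (fun l => g2⁻¹ j l - (1 : Matrix (Fin n) (Fin n) ℤ) j l)
      (fun l h => hK'' _ _ _ _ (hinv _ hcg j l))
    have : g2 * x h 1 = A * (x h 1 * g2) := by
      ext i l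
      rw [mul_x_apply, rowA_mul hA', x_mul_apply]
      have e : ∑ k ∈ Finset.univ.erase a, (g2⁻¹ j k - (1 : Matrix (Fin n) (Fin n) ℤ) j k) * (x h 1 * g2) k l
          = (1 : Matrix (Fin n) (Fin n) ℤ) j l - g2 j l := by
        calc _ = ∑ k ∈ Finset.univ.erase a, (g2⁻¹ j k - (1 : Matrix (Fin n) (Fin n) ℤ) j k) * g2 k l := by
              refine Finset.sum_congr rfl fun k hk => ?_
              rw [x_mul_apply]; simp at hk; simp [hk]
          _ = ∑ k, (g2⁻¹ j k - (1 : Matrix (Fin n) (Fin n) ℤ) j k) * g2 k l := by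
              apply Finset.sum_erase; simp [hic]
          _ = _ := by
              simp only [sub_mul, Finset.sum_sub_distrib, hii]
              rw [← Matrix.mul_apply, one_mul]
      rw [e, hc2]
      by_cases h1 : i = a <;> by_cases h2 : l = j <;> simp [h1, h2, Ne.symm, Matrix.one_apply, eq_comm]
      all_goals (intro h3; exact absurd h3.symm h2)
    rw [← QuotientGroup.mk_mul, this, QuotientGroup.mk_mul, (QuotientGroup.eq_one_iff A).2 hA, one_mul,
      QuotientGroup.mk_mul]
  have R2 : ∀ j (h : j ≠ a), (QuotientGroup.mk g2 : S n ⧸ K) * QuotientGroup.mk (x h 1) = QuotientGroup.mk (x h 1) * QuotientGroup.mk g2 := by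
    intro j h
    obtain ⟨A, hA, hA'⟩ := colEx K a (fun l => g2 l j - (1 : Matrix (Fin n) (Fin n) ℤ) l j)
      (fun l h => hK'' _ _ _ _ (hcg l j))
    have : g2 * x h 1 = A * (x h 1 * g2) := by
      ext i l
      rw [mul_x_apply, colA_mul hA', x_mul_apply, x_mul_apply]
      rw [hr2]
      by_cases h2 : l = a
      · subst h2
        by_cases h1 : i = l
        · subst h1; simp [Ne.symm h, hr2]
        · by_cases h3 : i = j
          · subst h3; simp [h1, Ne.symm h]
          · simp [h1, h3, Ne.symm h]
      · simp [h2, Ne.symm h, Matrix.one_apply, Ne.symm h2]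
    rw [← QuotientGroup.mk_mul, this, QuotientGroup.mk_mul, (QuotientGroup.eq_one_iff A).2 hA, one_mul,
      QuotientGroup.mk_mul]
  rw [hgg]
  have hgen : El n ≤ (Subgroup.centralizer {(QuotientGroup.mk g2 : S n ⧸ K)}).comap (QuotientGroup.mk' K) := by
    rw [El, Subgroup.closure_le]
    have h1 : ∀ i j (h : i ≠ j), x h 1 ∈ (Subgroup.centralizer {(QuotientGroup.mk g2 : S n ⧸ K)}).comap (QuotientGroup.mk' K) := by
      intro i j h
      by_cases hi : a = i
      · subst hi
        rw [Subgroup.mem_comap, Subgroup.mem_centralizer_singleton_iff]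
        exact (R1 j h).symm
      · by_cases hj : j = a
        · subst hj
          rw [Subgroup.mem_comap, Subgroup.mem_centralizer_singleton_iff]
          exact (R2 i h).symm
        · have := x_rel (Ne.symm hi) (Ne.symm hj) h 1 1
          rw [mul_one, ← mul_inv_eq_iff_eq_mul] at this
          rw [← this]
          have m1 : x (Ne.symm hi) 1 ∈ (Subgroup.centralizer {(QuotientGroup.mk g2 : S n ⧸ K)}).comap (QuotientGroup.mk' K) := by
            rw [Subgroup.mem_comap, Subgroup.mem_centralizer_singleton_iff]
            exact (R2 i _).symm
          have m2 : x (Ne.symm hj) 1 ∈ (Subgroup.centralizer {(QuotientGroup.mk g2 : S n ⧸ K)}).comap (QuotientGroup.mk' K) := by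
            rw [Subgroup.mem_comap, Subgroup.mem_centralizer_singleton_iff]
            exact (R1 j _).symm
          exact mul_mem (mul_mem m1 m2) (inv_mem (mul_mem m2 m1))
    rintro _ ⟨i, j, h, c, rfl⟩
    have := Subgroup.zpow_mem _ (h1 i j h) c
    rwa [x_zpow, mul_one] at this
  rw [El_eq_top] at hgen
  rw [Subgroup.mem_center_iff]
  intro q
  obtain ⟨y, rfl⟩ := QuotientGroup.mk_surjective q
  have := hgen (Subgroup.mem_top y)
  rw [Subgroup.mem_comap, Subgroup.mem_centralizer_singleton_iff] at this
  exact this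

lemma S_perfect (hn : 3 ≤ n) : commutator (S n) = ⊤ := by
  rw [eq_top_iff, ← El_eq_top, El, Subgroup.closure_le]
  rintro _ ⟨i, j, h, c, rfl⟩
  obtain ⟨k, hk⟩ : ∃ k, k ∉ ({i, j} : Finset (Fin n)) := by
    by_contra hcon
    push Not at hcon
    have h1 : (Finset.univ : Finset (Fin n)) ⊆ {i, j} := fun k _ => hcon k
    have := (Finset.card_le_card h1).trans Finset.card_le_two
    simp at this; omega
  simp only [Finset.mem_insert, Finset.mem_singleton, not_or] at hk
  have := x_rel (Ne.symm hk.1) hk.2 h c 1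
  rw [mul_one, ← mul_inv_eq_iff_eq_mul, _root_.mul_inv_rev] at this
  rw [← this, ← mul_assoc]
  exact Subgroup.commutator_mem_commutator (Subgroup.mem_top _) (Subgroup.mem_top _)

lemma finite_of_center {Q : Type*} [Group Q] (h : (Subgroup.center Q).FiniteIndex) (hp : commutator Q = ⊤) :
    Finite Q := by
  have : Finite (commutatorSet Q) := by
    have : Finite (Q ⧸ Subgroup.center Q) := inferInstance
    let f : (Q ⧸ Subgroup.center Q) × (Q ⧸ Subgroup.center Q) → Q := fun p => p.1.out * p.2.out * p.1.out⁻¹ * p.2.out⁻¹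
    refine Set.Finite.subset (Set.finite_range f) ?_
    rintro _ ⟨p, q, rfl⟩
    refine ⟨(p, q), ?_⟩
    obtain ⟨z, hz⟩ := QuotientGroup.mk_out_eq_mul (Subgroup.center Q) p
    obtain ⟨w, hw⟩ := QuotientGroup.mk_out_eq_mul (Subgroup.center Q) q
    have hz' := Subgroup.mem_center_iff.1 z.2
    have hw' := Subgroup.mem_center_iff.1 w.2
    simp only [f]
    rw [hz, hw, commutatorElement_def, _root_.mul_inv_rev, _root_.mul_inv_rev]
    generalize (z : Q) = z at *
    generalize (w : Q) = w at *
    have e1 : p * z * (q * w) * (z⁻¹ * p⁻¹) = p * q * p⁻¹ * w := by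
      calc _ = p * (z * (q * w)) * (z⁻¹ * p⁻¹) := by group
        _ = p * ((q * w) * z) * (z⁻¹ * p⁻¹) := by rw [hz']
        _ = p * q * (w * p⁻¹) := by group
        _ = p * q * (p⁻¹ * w) := by rw [hw']
        _ = _ := by group
    rw [e1]; group
  have h2 : Finite (commutator Q) := inferInstance
  rw [hp] at h2
  exact Finite.of_equiv _ Subgroup.topEquiv.toEquiv

lemma finite_quot {N : ℕ} (hN : 2 ≤ N) (K : Subgroup (S n)) [K.Normal]
    (hK : ∀ (i j : Fin n) (h : i ≠ j), x h N ∈ K) (hn : 3 ≤ n) : K.FiniteIndex := by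
  let Γ := (Matrix.SpecialLinearGroup.map (n := Fin n) (Int.castRingHom (ZMod N))).ker
  have : NeZero N := ⟨by omega⟩
  have hΓ : Γ.FiniteIndex := by
    have : Finite (Matrix.SpecialLinearGroup (Fin n) (ZMod N)) := by
      unfold Matrix.SpecialLinearGroup; infer_instance
    exact Subgroup.finiteIndex_ker _
  let L := K ⊓ Γ
  have hL : ∀ (i j : Fin n) (h : i ≠ j), x h N ∈ L := by
    intro i j h
    refine ⟨hK i j h, (Cg_mem _).2 ?_⟩
    intro k l
    rw [x_apply]
    split_ifs <;> simp
  have hc := comm_mod hN L hL (fun k hk => (Cg_mem _).1 hk.2) hn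
  have : Finite (S n ⧸ L) := by
    apply finite_of_center
    · have hle : Γ ≤ (Subgroup.center (S n ⧸ L)).comap (QuotientGroup.mk' L) :=
        fun g hg => hc g ((Cg_mem _).1 hg)
      have := Subgroup.finiteIndex_of_le hle
      have h3 := Subgroup.index_comap_of_surjective (Subgroup.center (S n ⧸ L)) (QuotientGroup.mk'_surjective L)
      exact ⟨by rw [← h3]; exact this.index_ne_zero⟩
    · rw [commutator_def, ← Subgroup.map_top_of_surjective _ (QuotientGroup.mk'_surjective L),
        ← Subgroup.map_commutator, ← commutator_def, S_perfect hn]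
  have hLf : L.FiniteIndex := Subgroup.finiteIndex_of_finite_quotient
  exact Subgroup.finiteIndex_of_le (inf_le_left : L ≤ K)
end RP
end Part4

section Part5
namespace RP
open Module

lemma nilp_of_spec {K E : Type*} [Field K] [IsAlgClosed K] [AddCommGroup E] [Module K E]
    [FiniteDimensional K E] (f : End K E) (h : ∀ μ, f.HasEigenvalue μ → μ = 0) : IsNilpotent f := by
  have h1 := Module.End.iSup_maxGenEigenspace_eq_top f
  have h2 : ⨆ μ, f.maxGenEigenspace μ ≤ f.maxGenEigenspace 0 := by
    refine iSup_le fun μ => ?_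
    by_cases hμ : μ = 0
    · rw [hμ]
    · have : ¬ f.HasEigenvalue μ := fun h' => hμ (h μ h')
      rw [Module.End.hasEigenvalue_iff, not_not] at this
      have h3 : f.maxGenEigenspace μ = ⊥ := by
        rw [Module.End.maxGenEigenspace_eq]
        by_contra hc
        have := Module.End.HasUnifEigenvalue.lt (k := ((f.maxGenEigenspaceIndex μ : ℕ) : ℕ∞)) (m := 1) (f := f) (μ := μ) (by simp) hc
        exact this (by simpa using ‹f.eigenspace μ = ⊥›)
      rw [h3]; exact bot_le
  rw [h1, top_le_iff, Module.End.maxGenEigenspace_eq] at h2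
  refine ⟨f.maxGenEigenspaceIndex 0, ?_⟩
  ext v
  have : v ∈ f.genEigenspace 0 (f.maxGenEigenspaceIndex 0) := by rw [h2]; trivial
  simpa [Module.End.mem_genEigenspace_nat] using this

lemma qu_alg {K E : Type*} [Field K] [IsAlgClosed K] [AddCommGroup E] [Module K E]
    [FiniteDimensional K E] (A B z A' B' : End K E) (hA : A' * A = 1) (hB : B' * B = 1)
    (h : A * B = z * (B * A)) (hzA : z * A = A * z) (hzB : z * B = B * z) (m : ℕ)
    (hm : finrank K E ≤ m) :
    IsNilpotent (z ^ m.factorial - 1) := by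
  apply nilp_of_spec
  intro μ hμ
  have h1 := Module.End.hasEigenvalue_iff_mem_spectrum.1 hμ
  have e : z ^ m.factorial - 1 = Polynomial.aeval z (Polynomial.X ^ m.factorial - 1 : Polynomial K) := by simp
  rw [e] at h1
  have hne : Nontrivial E := by
    by_contra hn
    rw [not_nontrivial_iff_subsingleton] at hn
    obtain ⟨v, hv⟩ := hμ.exists_hasEigenvector
    exact hv.2 (Subsingleton.elim _ _)
  rw [spectrum.map_polynomial_aeval_of_degree_pos] at h1
  swap
  · rw [show (1 : Polynomial K) = Polynomial.C 1 by simp, Polynomial.degree_X_pow_sub_C (Nat.factorial_pos m)]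
    exact_mod_cast Nat.factorial_pos m
  obtain ⟨l, hl, rfl⟩ := h1
  have hl := Module.End.hasEigenvalue_iff_mem_spectrum.2 hl
  let W := z.eigenspace l
  have hAW : ∀ v ∈ W, A v ∈ W := by
    intro v hv
    rw [Module.End.mem_eigenspace_iff] at *
    have := congrArg (fun f => f v) hzA
    simp only [Module.End.mul_apply] at this
    rw [this, hv, map_smul]
  have hBW : ∀ v ∈ W, B v ∈ W := by
    intro v hv
    rw [Module.End.mem_eigenspace_iff] at *
    have := congrArg (fun f => f v) hzB
    simp only [Module.End.mul_apply] at this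
    rw [this, hv, map_smul]
  let a : End K W := A.restrict hAW
  let b : End K W := B.restrict hBW
  have hinj : ∀ (A A' : End K E) (hA : A' * A = 1) (hAW : ∀ v ∈ W, A v ∈ W), LinearMap.det (A.restrict hAW) ≠ 0 := by
    intro A A' hA hAW
    have : LinearMap.ker (A.restrict hAW) = ⊥ := by
      rw [LinearMap.ker_eq_bot']
      intro v hv
      have h2 : A v = 0 := congrArg Subtype.val hv
      have h3 := congrArg (fun f => f (v : E)) hA
      simp only [Module.End.mul_apply, h2, map_zero, Module.End.one_apply] at h3
      exact Subtype.ext h3.symm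
    intro h0
    have := LinearMap.bot_lt_ker_of_det_eq_zero h0
    simp_all
  have hab : a * b = l • (b * a) := by
    ext v
    have h3 := congrArg (fun f => f (v : E)) h
    simp only [Module.End.mul_apply] at h3
    have h4 := Module.End.mem_eigenspace_iff.1 (hBW _ (hAW _ v.2))
    rw [h4] at h3
    exact h3
  have hd := congrArg LinearMap.det hab
  rw [LinearMap.det_smul, map_mul, map_mul] at hd
  have ha := hinj A A' hA hAW
  have hb := hinj B B' hB hBW
  have hl1 : l ^ finrank K W = 1 := by
    have : LinearMap.det a * LinearMap.det b ≠ 0 := mul_ne_zero ha hb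
    rw [mul_comm (LinearMap.det b)] at hd
    exact (mul_eq_right₀ this).1 hd.symm
  have hpos : 0 < finrank K W := by
    rw [Module.finrank_pos_iff]
    exact Submodule.nontrivial_iff_ne_bot.2 hl
  have hdiv : finrank K W ∣ m.factorial := Nat.dvd_factorial hpos ((Submodule.finrank_le W).trans hm)
  obtain ⟨q, hq⟩ := hdiv
  simp [hq, pow_mul, hl1]

lemma exC (E : Type*) [AddCommGroup E] [Module ℚ E] [FiniteDimensional ℚ E] :
    ∃ φ : End ℚ E →+* End ℂ (Fin (finrank ℚ E) → ℂ), Function.Injective φ ∧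
      (∀ f, LinearMap.trace ℂ _ (φ f) = ((LinearMap.trace ℚ E f : ℚ) : ℂ)) ∧
      (∀ (q : ℚ) f, φ (q • f) = (q : ℂ) • φ f) := by
  let b := Module.finBasis ℚ E
  let e := LinearMap.toMatrixAlgEquiv b
  let M := (algebraMap ℚ ℂ).mapMatrix (m := Fin (finrank ℚ E))
  let t := Matrix.toLinAlgEquiv' (R := ℂ) (n := Fin (finrank ℚ E))
  refine ⟨(t : _ →+* _).comp (M.comp (e : _ →+* _)), ?_, ?_, ?_⟩
  · intro x y h
    exact e.injective (Matrix.map_injective (algebraMap ℚ ℂ).injective (t.injective h))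
  · intro f
    change LinearMap.trace ℂ _ (Matrix.toLin' (M (e f))) = _
    rw [Matrix.trace_toLin'_eq, LinearMap.trace_eq_matrix_trace ℚ b]
    simp [M, e, Matrix.trace, LinearMap.toMatrixAlgEquiv]
  · intro q f
    change t (M (e (q • f))) = (q : ℂ) • t (M (e f))
    have : M (e (q • f)) = (q : ℂ) • M (e f) := by
      rw [map_smul]
      ext i j
      simp [M]
    rw [this, map_smul]

lemma qu {E : Type*} [AddCommGroup E] [Module ℚ E] [FiniteDimensional ℚ E]
    (A B z A' B' : End ℚ E) (hA : A' * A = 1) (hB : B' * B = 1)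
    (h : A * B = z * (B * A)) (hzA : z * A = A * z) (hzB : z * B = B * z) :
    IsNilpotent (z ^ (finrank ℚ E).factorial - 1) := by
  obtain ⟨φ, hφ, -, -⟩ := exC E
  rw [← IsNilpotent.map_iff hφ, map_sub, map_pow, map_one]
  refine qu_alg (φ A) (φ B) (φ z) (φ A') (φ B') ?_ ?_ ?_ ?_ ?_ _ (by simp)
  · rw [← map_mul, hA, map_one]
  · rw [← map_mul, hB, map_one]
  · rw [← map_mul, h]; simp
  · rw [← map_mul, hzA]; simp
  · rw [← map_mul, hzB]; simp
end RP
end Part5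

section Part6
namespace RP
set_option linter.unusedSectionVars false
open Polynomial
variable {R : Type*} [Ring R] [Algebra ℚ R]

noncomputable def ev (t : ℕ) : R[X] →+* R :=
  Polynomial.eval₂RingHom' (RingHom.id R) (t : R) (fun a => (Nat.cast_commute t a).symm)

@[simp] lemma ev_C (t : ℕ) (a : R) : ev t (C a) = a := by
  simp [ev, Polynomial.eval₂RingHom']
@[simp] lemma ev_X (t : ℕ) : ev t (X : R[X]) = t := by
  simp [ev, Polynomial.eval₂RingHom']

lemma ev_sum (t : ℕ) (p : R[X]) : ev t p = ∑ k ∈ Finset.range (p.natDegree + 1), ((t : ℚ) ^ k) • p.coeff k := by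
  conv_lhs => rw [p.as_sum_range_C_mul_X_pow]
  rw [map_sum]
  refine Finset.sum_congr rfl fun k _ => ?_
  rw [map_mul, map_pow, ev_C, ev_X, Algebra.smul_def]
  simp only [map_pow, map_natCast]
  exact ((Nat.cast_commute t _).pow_left k).symm

lemma ev_zero_imp (p : R[X]) (h : ∀ t, ev t p = 0) : p = 0 := by
  ext k
  rw [coeff_zero, ← Module.forall_dual_apply_eq_zero_iff ℚ]
  intro f
  let P : ℚ[X] := ∑ k ∈ Finset.range (p.natDegree + 1), C (f (p.coeff k)) * X ^ k
  have hP : P = 0 := by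
    apply Polynomial.eq_zero_of_infinite_isRoot
    refine Set.Infinite.mono ?_ (Set.infinite_range_of_injective (Nat.cast_injective (R := ℚ)))
    rintro _ ⟨t, rfl⟩
    have := congrArg f (h t)
    rw [ev_sum, map_sum, map_zero] at this
    simp only [P, Set.mem_ofPred_eq, IsRoot, eval_finsetSum]
    rw [← this]
    refine Finset.sum_congr rfl fun k _ => ?_
    rw [eval_mul, eval_C, eval_pow, eval_X, map_smul, smul_eq_mul, mul_comm]
  have := congrArg (fun q => coeff q k) hP
  simp only [P, finsetSum_coeff, coeff_C_mul, coeff_X_pow, coeff_zero] at this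
  by_cases hk : k < p.natDegree + 1
  · simpa [hk] using this
  · rw [coeff_eq_zero_of_natDegree_lt (by omega)]; simp

lemma ev_inj {p q : R[X]} (h : ∀ t, ev t p = ev t q) : p = q := by
  rw [← sub_eq_zero]; apply ev_zero_imp; intro t; rw [map_sub, h, sub_self]

def IsLog (u L : R) : Prop := ∃ p : R[X], p.coeff 1 = L ∧ ∀ t, ev t p = u ^ t

lemma coeff_zero_ev (p : R[X]) : ev 0 p = p.coeff 0 := by
  rw [ev_sum, Finset.sum_range_succ']
  simp

lemma log_c0 {p : R[X]} {u : R} (h : ∀ t, ev t p = u ^ t) : p.coeff 0 = 1 := by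
  rw [← coeff_zero_ev, h, pow_zero]

lemma IsLog.unique {u L L' : R} (h : IsLog u L) (h' : IsLog u L') : L = L' := by
  obtain ⟨p, rfl, hp⟩ := h
  obtain ⟨q, rfl, hq⟩ := h'
  rw [ev_inj (p := p) (q := q) (fun t => by rw [hp, hq])]

lemma IsLog.conj {u L g g' : R} (hg : g' * g = 1) (h : IsLog u L) (hg' : g * g' = 1) :
    IsLog (g * u * g') (g * L * g') := by
  obtain ⟨p, rfl, hp⟩ := h
  refine ⟨C g * p * C g', by simp, fun t => ?_⟩
  rw [map_mul, map_mul, hp, ev_C, ev_C]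
  induction t with
  | zero => simp [hg']
  | succ k ih =>
    rw [pow_succ (g * u * g'), ← ih]
    calc g * u ^ (k + 1) * g' = g * u ^ k * 1 * u * g' := by rw [pow_succ]; noncomm_ring
      _ = _ := by rw [← hg]; noncomm_ring

lemma IsLog.mul {u v L M : R} (h : IsLog u L) (h' : IsLog v M) (hc : Commute u v) :
    IsLog (u * v) (L + M) := by
  obtain ⟨p, rfl, hp⟩ := h
  obtain ⟨q, rfl, hq⟩ := h'
  refine ⟨p * q, ?_, fun t => ?_⟩
  · rw [mul_coeff_one, log_c0 hp, log_c0 hq]; simp [add_comm]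
  · rw [map_mul, hp, hq, hc.mul_pow]

lemma IsLog.one : IsLog (1 : R) 0 := ⟨1, by simp [coeff_one], fun t => by simp⟩

lemma IsLog.pow {u L : R} (h : IsLog u L) (k : ℕ) : IsLog (u ^ k) (k • L) := by
  induction k with
  | zero => simpa using IsLog.one
  | succ k ih => rw [pow_succ, succ_nsmul]; exact ih.mul h (Commute.pow_self u k)

lemma IsLog.commute {u L a : R} (h : IsLog u L) (hc : Commute u a) : Commute L a := by
  obtain ⟨p, rfl, hp⟩ := h
  have : p * C a = C a * p := by
    apply ev_inj; intro t
    rw [map_mul, map_mul, hp, ev_C, (hc.pow_left t).eq]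
  have := congrArg (fun q => coeff q 1) this
  simp only [coeff_mul_C, coeff_C_mul] at this
  exact this

lemma IsLog.brk {u L Z Y : R} (h : IsLog u L) (h1 : u * Z = (Z + Y) * u) (hc : Commute u Y) :
    L * Z - Z * L = Y := by
  obtain ⟨p, rfl, hp⟩ := h
  have : p * C Z = (C Z + C Y * X) * p := by
    apply ev_inj; intro t
    simp only [map_mul, map_add, hp, ev_C, ev_X]
    induction t with
    | zero => simp
    | succ k ih =>
      have h2 := (hc.pow_left k).eq
      calc u ^ (k + 1) * Z = u ^ k * (u * Z) := by rw [pow_succ, mul_assoc]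
        _ = (u ^ k * Z + u ^ k * Y) * u := by rw [h1]; noncomm_ring
        _ = ((Z + Y * k) * u ^ k + Y * u ^ k) * u := by rw [ih, h2]
        _ = _ := by push_cast; rw [pow_succ]; noncomm_ring
  have := congrArg (fun q => coeff q 1) this
  simp only [coeff_mul_C, mul_coeff_one, log_c0 hp, coeff_add, coeff_C_zero, coeff_C_succ, mul_one, 
    coeff_C_mul, coeff_X_one, coeff_X_zero, mul_zero, add_zero, zero_add] at this
  rw [this]; abel

lemma exLog (u : R) (hu : IsNilpotent (u - 1)) :
    ∃ L, IsLog u L ∧ ∃ q, Commute u q ∧ L = (u - 1) * (1 + (u - 1) * q) := by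
  obtain ⟨m, hm⟩ := hu
  have hm : (u - 1) ^ (m + 2) = 0 := by rw [pow_add, hm, zero_mul]
  let b : ℕ → ℚ[X] := fun k => C ((k.factorial : ℚ)⁻¹) * descPochhammer ℚ k
  let p : R[X] := ∑ k ∈ Finset.range (m + 2), (b k).map (algebraMap ℚ R) * C ((u - 1) ^ k)
  have hev : ∀ (t : ℕ) (q : ℚ[X]), ev t (q.map (algebraMap ℚ R)) = algebraMap ℚ R (q.eval (t : ℚ)) := by
    intro t q
    have : (ev t : R[X] →+* R).comp (Polynomial.mapRingHom (algebraMap ℚ R)) = 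
      (algebraMap ℚ R).comp (Polynomial.evalRingHom (t : ℚ)) := by
      apply Polynomial.ringHom_ext
      · intro a
        simp only [RingHom.comp_apply, coe_mapRingHom, map_C, ev_C, coe_evalRingHom, eval_C]
      · simp only [RingHom.comp_apply, coe_mapRingHom, map_X, ev_X, coe_evalRingHom, eval_X, map_natCast]
    exact congrArg (fun f => f q) this
  refine ⟨p.coeff 1, ⟨p, rfl, fun t => ?_⟩, ∑ k ∈ Finset.range m, (b (k + 2)).coeff 1 • (u - 1) ^ k, ?_, ?_⟩
  · have h1 : u ^ t = ∑ k ∈ Finset.range (t + 1), (t.choose k : R) * (u - 1) ^ k := by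
      conv_lhs => rw [show u = (u - 1) + 1 by abel]
      rw [(Commute.one_right (u - 1)).add_pow]
      refine Finset.sum_congr rfl fun k _ => ?_
      rw [one_pow, mul_one]; exact (Nat.cast_commute _ _).symm
    have h2 : ev t p = ∑ k ∈ Finset.range (m + 2), (t.choose k : R) * (u - 1) ^ k := by
      rw [map_sum]
      refine Finset.sum_congr rfl fun k _ => ?_
      rw [map_mul, ev_C, hev]
      have : (b k).eval (t : ℚ) = (t.choose k : ℚ) := by
        simp only [b, eval_mul, eval_C, descPochhammer_eval_eq_descFactorial]
        rw [Nat.descFactorial_eq_factorial_mul_choose]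
        push_cast
        have : (k.factorial : ℚ) ≠ 0 := by positivity
        field_simp
      rw [this, map_natCast]
    have h3 : ∀ M, t + 1 ≤ M → ∑ k ∈ Finset.range (t + 1), (t.choose k : R) * (u - 1) ^ k
        = ∑ k ∈ Finset.range M, (t.choose k : R) * (u - 1) ^ k := by
      intro M hM
      apply Finset.sum_subset (by simpa using hM)
      intro k _ hk
      simp only [Finset.mem_range] at hk
      rw [Nat.choose_eq_zero_of_lt (by omega)]; simp
    have h4 : ∀ M, m + 2 ≤ M → ∑ k ∈ Finset.range (m + 2), (t.choose k : R) * (u - 1) ^ k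
        = ∑ k ∈ Finset.range M, (t.choose k : R) * (u - 1) ^ k := by
      intro M hM
      apply Finset.sum_subset (by simpa using hM)
      intro k _ hk
      simp only [Finset.mem_range] at hk
      rw [pow_eq_zero_of_le (by omega) hm, mul_zero]
    rw [h1, h2, h3 (max (t + 1) (m + 2)) (le_max_left _ _), h4 (max (t + 1) (m + 2)) (le_max_right _ _)]
  · apply Commute.sum_right
    intro k _
    apply Commute.smul_right
    apply Commute.pow_right
    exact (Commute.refl u).sub_right (Commute.one_right u)
  · simp only [p, finsetSum_coeff, coeff_mul_C, coeff_map]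
    rw [Finset.sum_range_succ', Finset.sum_range_succ']
    have b0 : (b 0).coeff 1 = 0 := by simp [b, coeff_one]
    have b1 : (b 1).coeff 1 = 1 := by simp [b]
    rw [b0]
    simp only [zero_add, b1]
    rw [Finset.mul_sum, mul_add, Finset.mul_sum]
    simp only [map_one, one_mul, map_zero, zero_mul, add_zero, pow_one, mul_one]
    rw [add_comm]
    congr 1
    refine Finset.sum_congr rfl fun k _ => ?_
    rw [mul_smul_comm, mul_smul_comm, ← Algebra.smul_def, pow_succ', pow_succ']
end RP
end Part6

section Part7
namespace RP
open Module
attribute [local instance] LieRing.ofAssociativeRing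

lemma sl2_int {E : Type*} [AddCommGroup E] [Module ℂ E] [FiniteDimensional ℂ E] (h e f : End ℂ E)
    (hef : ⁅e, f⁆ = h) (hhe : ⁅h, e⁆ = 2 • e) (hhf : ⁅h, f⁆ = -(2 • f)) (μ : ℂ)
    (hμ : h.HasEigenvalue μ) : ∃ k : ℤ, μ = k := by
  obtain ⟨m, hm⟩ := hμ.exists_hasEigenvector
  have hm1 := hm.apply_eq_smul
  have hm2 := hm.2
  by_cases h0 : h = 0
  · refine ⟨0, ?_⟩
    rw [h0] at hm1
    simp only [LinearMap.zero_apply] at hm1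
    simpa [hm2] using hm1.symm
  have t : IsSl2Triple h e f := ⟨h0, hef, hhe, hhf⟩
  have key := IsSl2Triple.lie_h_pow_toEnd_e (R := ℂ) (M := E) (m := m) (μ := μ) t hm1
  set g := LieModule.toEnd ℂ (End ℂ E) E e with hg
  have hz : ∃ k, (g ^ k) m = 0 := by
    by_contra! hcon
    have hfin : (Set.ofPred fun ν : ℂ => h.HasEigenvalue ν).Finite := by
      refine Set.Finite.subset (Module.End.finite_spectrum h) ?_
      intro ν hν
      exact Module.End.hasEigenvalue_iff_mem_spectrum.1 hν
    refine (Set.infinite_range_of_injective (f := fun k : ℕ => μ + 2 * (k : ℂ)) ?_) (hfin.subset ?_)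
    · intro a b hab
      simpa using hab
    · rintro _ ⟨k, rfl⟩
      exact Module.End.hasEigenvalue_of_hasEigenvector (x := (g ^ k) m)
        ⟨Module.End.mem_eigenspace_iff.2 (key k), hcon k⟩
  obtain ⟨k, hk1, hk2⟩ := Nat.exists_not_and_succ_of_not_zero_of_exists (p := fun k => (g ^ k) m = 0) (by simpa using hm2) hz
  have P : t.HasPrimitiveVectorWith ((g ^ k) m) (μ + 2 * k) := 
    ⟨hk1, key k, by rw [pow_succ'] at hk2; exact hk2⟩
  obtain ⟨q, hq⟩ := P.exists_nat
  refine ⟨q - 2 * k, ?_⟩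
  push_cast
  rw [← hq]; ring

lemma sl2_tr_C {E : Type*} [AddCommGroup E] [Module ℂ E] [FiniteDimensional ℂ E] (h e f : End ℂ E)
    (hef : ⁅e, f⁆ = h) (hhe : ⁅h, e⁆ = 2 • e) (hhf : ⁅h, f⁆ = -(2 • f)) :
    (∃ k : ℕ, LinearMap.trace ℂ E (h * h) = k) ∧ 
    (LinearMap.trace ℂ E (h * h) = 0 → IsNilpotent h) := by
  have hr : ∀ ν, (h * h).HasEigenvalue ν → ∃ k : ℕ, ν = k := by
    intro ν hν
    have hne : Nontrivial E := by
      by_contra hn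
      rw [not_nontrivial_iff_subsingleton] at hn
      obtain ⟨v, hv⟩ := hν.exists_hasEigenvector
      exact hv.2 (Subsingleton.elim _ _)
    have h1 := Module.End.hasEigenvalue_iff_mem_spectrum.1 hν
    rw [← pow_two, spectrum.map_pow_of_pos h (by norm_num : 0 < 2)] at h1
    obtain ⟨μ, hμ, rfl⟩ := h1
    obtain ⟨k, rfl⟩ := sl2_int h e f hef hhe hhf μ (Module.End.hasEigenvalue_iff_mem_spectrum.2 hμ)
    refine ⟨k.natAbs ^ 2, ?_⟩
    have h3 : ((k.natAbs : ℤ) ^ 2) = k ^ 2 := Int.natAbs_sq k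
    have h4 := congrArg (fun z : ℤ => (z : ℂ)) h3
    rw [Nat.cast_pow]
    simpa only [Int.cast_pow, Int.cast_natCast] using h4.symm
  have ht := Module.End.trace_eq_sum_roots_charpoly_of_splits (IsAlgClosed.splits (h * h).charpoly)
  have hroot : ∀ ν ∈ (h * h).charpoly.roots, ∃ k : ℕ, ν = k := by
    intro ν hν
    exact hr ν ((Module.End.hasEigenvalue_iff_isRoot_charpoly _ _).2 (Polynomial.isRoot_of_mem_roots hν))
  have hms : ∀ s : Multiset ℂ, (∀ ν ∈ s, ∃ k : ℕ, ν = k) → ∃ k : ℕ, s.sum = k ∧ (k = 0 → ∀ ν ∈ s, ν = 0) := by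
    intro s
    induction s using Multiset.induction with
    | empty => intro _; exact ⟨0, by simp⟩
    | cons a s ih =>
      intro hs
      obtain ⟨k, hk, hk'⟩ := ih (fun ν hν => hs ν (by simp [hν]))
      obtain ⟨l, rfl⟩ := hs a (by simp)
      refine ⟨l + k, by simp [hk], ?_⟩
      intro h0 ν hν
      rcases Multiset.mem_cons.1 hν with rfl | hν
      · simp; omega
      · exact hk' (by omega) ν hν
  obtain ⟨k, hk, hk'⟩ := hms _ hroot
  rw [ht]
  refine ⟨⟨k, hk⟩, ?_⟩
  intro h0
  have hk0 : k = 0 := by rw [hk] at h0; exact_mod_cast h0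
  have : IsNilpotent (h * h) := by
    apply nilp_of_spec
    intro μ hμ
    apply hk' hk0
    rw [Polynomial.mem_roots (LinearMap.charpoly_monic _).ne_zero]
    exact (Module.End.hasEigenvalue_iff_isRoot_charpoly _ _).1 hμ
  rw [← pow_two] at this
  exact (IsNilpotent.pow_iff_pos (by norm_num)).1 this

lemma sl2_tr {E : Type*} [AddCommGroup E] [Module ℚ E] [FiniteDimensional ℚ E] (h e f : End ℚ E)
    (hef : ⁅e, f⁆ = h) (hhe : ⁅h, e⁆ = 2 • e) (hhf : ⁅h, f⁆ = -(2 • f)) :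
    0 ≤ LinearMap.trace ℚ E (h * h) ∧ 
    (LinearMap.trace ℚ E (h * h) = 0 → e = 0) := by
  obtain ⟨φ, hφ, htr, -⟩ := exC E
  have h1 := sl2_tr_C (φ h) (φ e) (φ f)
    (by rw [← hef]; simp [Ring.lie_def]) (by rw [← map_nsmul, ← hhe]; simp [Ring.lie_def])
    (by rw [← map_nsmul, ← map_neg, ← hhf]; simp [Ring.lie_def])
  rw [← map_mul, htr] at h1
  obtain ⟨⟨k, hk⟩, h2⟩ := h1
  have hk : LinearMap.trace ℚ E (h * h) = k := by exact_mod_cast hk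
  refine ⟨by rw [hk]; positivity, ?_⟩
  intro h0
  have hnil : IsNilpotent h := by
    rw [← IsNilpotent.map_iff hφ]; exact h2 (by rw [h0]; simp)
  have hu : IsUnit (h + (2 : ℚ) • (1 : End ℚ E)) := by
    apply IsNilpotent.isUnit_add_right_of_commute hnil
    · refine ⟨⟨(2 : ℚ) • 1, (2⁻¹ : ℚ) • 1, ?_, ?_⟩, rfl⟩ <;> simp [smul_smul]
    · exact (Commute.one_right h).smul_right _
  have hc : h * e = e * (h + (2 : ℚ) • (1 : End ℚ E)) := by
    rw [Ring.lie_def, sub_eq_iff_eq_add] at hhe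
    rw [hhe, mul_add, mul_smul_comm, mul_one, two_smul, two_smul]; abel
  have hp : ∀ k : ℕ, h ^ k * e = e * (h + (2 : ℚ) • (1 : End ℚ E)) ^ k := by
    intro k
    induction k with
    | zero => simp
    | succ k ih => rw [pow_succ, mul_assoc, hc, ← mul_assoc, ih, mul_assoc, ← pow_succ]
  obtain ⟨m, hm⟩ := hnil
  have := hp m
  rw [hm, zero_mul] at this
  exact ((hu.pow m).mul_left_eq_zero).1 this.symm
end RP
end Part7

section Part8
namespace RP
open Module
attribute [local instance] LieRing.ofAssociativeRing
variable {n : ℕ}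

structure IsGl {R : Type*} [Ring R] (Y : Fin n → Fin n → R) : Prop where
  br : ∀ i j k l, ⁅Y i j, Y k l⁆ = (if j = k then Y i l else 0) - (if i = l then Y k j else 0)
  tr : ∑ i, Y i i = 0

def Cas {R : Type*} [Ring R] (Y : Fin n → Fin n → R) : R := ∑ i, ∑ j, Y i j * Y j i

lemma Cas_comm {R : Type*} [Ring R] {Y : Fin n → Fin n → R} (h : IsGl Y) (k l : Fin n) :
    Y k l * Cas Y = Cas Y * Y k l := by
  rw [← sub_eq_zero, Cas, Finset.mul_sum, Finset.sum_mul, ← Finset.sum_sub_distrib]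
  simp only [Finset.mul_sum, Finset.sum_mul, ← Finset.sum_sub_distrib]
  have : ∀ i j, Y k l * (Y i j * Y j i) - Y i j * Y j i * Y k l
      = ((if l = i then Y k j else 0) - (if k = j then Y i l else 0)) * Y j i +
        Y i j * ((if l = j then Y k i else 0) - (if k = i then Y j l else 0)) := by
    intro i j
    rw [← h.br, ← h.br, Ring.lie_def, Ring.lie_def]; noncomm_ring
  simp only [this, Finset.sum_add_distrib, sub_mul, mul_sub, Finset.sum_sub_distrib, ite_mul, mul_ite,
    zero_mul, mul_zero]
  rw [Finset.sum_comm (f := fun i j => if l = i then Y k j * Y j i else 0)]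
  rw [Finset.sum_comm (f := fun i j => if k = i then Y i j * Y j l else 0)]
  simp

lemma lemA {M : Type*} [AddCommGroup M] [Module ℚ M] [FiniteDimensional ℚ M]
    {Y : Fin n → Fin n → End ℚ M} (h : IsGl Y) (hn : IsNilpotent (Cas Y)) (i j : Fin n) (hij : i ≠ j) :
    Y i j = 0 := by
  let T := LinearMap.trace ℚ M
  have tc : ∀ a b : End ℚ M, T (a * b) = T (b * a) := fun a b => LinearMap.trace_mul_comm ℚ a b
  have h1 : T (Cas Y) = 0 := by
    have := LinearMap.isNilpotent_trace_of_isNilpotent hn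
    exact this.eq_zero
  have h2 : ∀ i j, i ≠ j → T (Y i j * Y j i) = T (Y i i * Y i i) - T (Y i i * Y j j) := by
    intro i j hij
    have e1 : Y i i * Y i j - Y i j * Y i i = Y i j := by
      have := h.br i i i j
      rw [Ring.lie_def] at this; rw [this]; simp [hij]
    have e2 : Y i j * Y j i - Y j i * Y i j = Y i i - Y j j := by
      have := h.br i j j i
      rw [Ring.lie_def] at this; rw [this]; simp
    calc T (Y i j * Y j i) = T ((Y i i * Y i j - Y i j * Y i i) * Y j i) := by rw [e1]
      _ = T (Y i i * Y i j * Y j i) - T (Y i j * (Y i i * Y j i)) := by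
        rw [sub_mul, map_sub, mul_assoc (Y i j)]
      _ = T (Y i i * (Y i j * Y j i - Y j i * Y i j)) := by
        rw [tc (Y i j), mul_sub, map_sub]; simp only [mul_assoc]
      _ = _ := by rw [e2, mul_sub, map_sub]
  have h3 : ∀ i j, T (Y i j * Y j i) = T (Y i i * Y i i) - T (Y i i * Y j j) + 
      (if i = j then T (Y i i * Y i i) else 0) := by
    intro i j
    by_cases hij : i = j
    · subst hij; simp
    · rw [h2 i j hij]; simp [hij]
  have h4 : ∀ i, ∑ j, T (Y i i * Y j j) = 0 := by
    intro i
    rw [← map_sum, ← Finset.mul_sum, h.tr]; simp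
  have h4' : ∀ i, ∑ j, T (Y j j * Y i i) = 0 := by
    intro i
    rw [← map_sum, ← Finset.sum_mul, h.tr]; simp
  have h5 : ((n : ℚ) + 1) * ∑ i, T (Y i i * Y i i) = 0 := by
    rw [← h1, Cas, map_sum, Finset.mul_sum]
    refine Finset.sum_congr rfl fun i _ => ?_
    rw [map_sum]
    rw [Finset.sum_congr rfl (fun j _ => h3 i j)]
    simp only [Finset.sum_add_distrib, Finset.sum_sub_distrib, h4]
    simp only [Finset.sum_const, Finset.card_univ, Fintype.card_fin, nsmul_eq_mul, Finset.sum_ite_eq,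
      Finset.mem_univ, if_true]
    ring
  have h6 : ∑ i, T (Y i i * Y i i) = 0 := by
    have : ((n : ℚ) + 1) ≠ 0 := by positivity
    exact (mul_eq_zero.1 h5).resolve_left this
  have hsl : ∀ i j, i ≠ j → 0 ≤ T ((Y i i - Y j j) * (Y i i - Y j j)) ∧ 
      (T ((Y i i - Y j j) * (Y i i - Y j j)) = 0 → Y i j = 0) := by
    intro i j hij
    apply sl2_tr (Y i i - Y j j) (Y i j) (Y j i)
    · rw [h.br]; simp
    · rw [sub_lie, h.br, h.br]; simp [hij, Ne.symm hij, two_smul]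
    · rw [sub_lie, h.br, h.br]; simp [hij, Ne.symm hij, two_smul]; abel
  have h7 : ∑ i, ∑ j, T ((Y i i - Y j j) * (Y i i - Y j j)) = 0 := by
    have : ∀ i j, T ((Y i i - Y j j) * (Y i i - Y j j)) = 
      T (Y i i * Y i i) - T (Y i i * Y j j) - T (Y j j * Y i i) + T (Y j j * Y j j) := by
      intro i j
      rw [← map_sub, ← map_sub, ← map_add]; congr 1; noncomm_ring
    simp only [this, Finset.sum_add_distrib, Finset.sum_sub_distrib, h4, h4', h6]
    simp [← Finset.mul_sum, h6]
  have hnn : ∀ i j, 0 ≤ T ((Y i i - Y j j) * (Y i i - Y j j)) := by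
    intro i j
    by_cases hij : i = j
    · subst hij; simp
    · exact (hsl i j hij).1
  rw [Finset.sum_eq_zero_iff_of_nonneg (fun i _ => Finset.sum_nonneg fun j _ => hnn i j)] at h7
  have h8 := h7 i (Finset.mem_univ i)
  rw [Finset.sum_eq_zero_iff_of_nonneg (fun j _ => hnn i j)] at h8
  exact (hsl i j hij).2 (h8 j (Finset.mem_univ j))

lemma gl_fixed {E : Type*} [AddCommGroup E] [Module ℚ E] [FiniteDimensional ℚ E]
    {Y : Fin n → Fin n → End ℚ E} (h : IsGl Y) (f : E →ₗ[ℚ] ℚ) (hf : ∀ i j v, f (Y i j v) = 0) (e : E) :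
    ∃ w, f w = f e ∧ ∀ i j, i ≠ j → Y i j w = 0 := by
  obtain ⟨m, hm⟩ := (LinearMap.eventually_isCompl_ker_pow_range_pow (Cas Y)).exists_forall_of_atTop
  have hm := hm (m + 1) (by omega)
  have hcm : ∀ i j, Commute (Y i j) (Cas Y ^ (m + 1)) := fun i j => 
    Commute.pow_right (Cas_comm h i j) _
  set D := Cas Y ^ (m + 1) with hD
  have hfC : ∀ v, f (D v) = 0 := by
    intro v
    rw [hD, pow_succ', Module.End.mul_apply]
    generalize (Cas Y ^ m) v = v
    simp [Cas, LinearMap.sum_apply, map_sum, hf]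
  obtain ⟨w, hw, r, ⟨r, rfl⟩, hwr⟩ := Submodule.mem_sup.1 (hm.sup_eq_top ▸ Submodule.mem_top (x := e))
  refine ⟨w, by rw [← hwr, map_add, hfC, add_zero], ?_⟩
  let M := LinearMap.ker D
  have hst : ∀ i j, ∀ v ∈ M, Y i j v ∈ M := by
    intro i j v hv
    have := congrArg (fun g => g v) (hcm i j).eq
    simp only [Module.End.mul_apply] at this
    rw [LinearMap.mem_ker] at *
    rw [← this, hv, map_zero]
  let Z : Fin n → Fin n → End ℚ M := fun i j => (Y i j).restrict (hst i j)
  have hZ : IsGl Z := by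
    constructor
    · intro i j k l
      ext v
      have := congrArg (fun g => g (v : E)) (h.br i j k l)
      have e : ((⁅Z i j, Z k l⁆ v : M) : E) = ⁅Y i j, Y k l⁆ (v : E) := by
        simp [Ring.lie_def, Z]
      rw [e, h.br]
      split_ifs <;> simp [Z]
    · ext v
      have := congrArg (fun g => g (v : E)) h.tr
      simp only [LinearMap.sum_apply] at this
      simp only [Z, LinearMap.sum_apply, AddSubmonoidClass.coe_finsetSum, LinearMap.coe_restrict_apply, this]
      simp
  have hCas : ∀ v : M, ((Cas Z v : M) : E) = Cas Y (v : E) := by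
    intro v
    simp [Cas, LinearMap.sum_apply, Z]
  have hnil : IsNilpotent (Cas Z) := by
    refine ⟨m + 1, ?_⟩
    have : ∀ k (v : M), (((Cas Z ^ k) v : M) : E) = (Cas Y ^ k) (v : E) := by
      intro k
      induction k with
      | zero => simp
      | succ k ih => intro v; rw [pow_succ, pow_succ, Module.End.mul_apply, Module.End.mul_apply, ih, hCas]
    ext v
    rw [this]
    exact v.2
  intro i j hij
  have := congrArg (fun g => ((g ⟨w, hw⟩ : M) : E)) (lemA hZ hnil i j hij)
  simpa [Z] using this
end RP
end Part8

section Part9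
namespace RP
set_option linter.unusedSectionVars false
attribute [local instance] LieRing.ofAssociativeRing
variable {n : ℕ}

lemma third (hn : 3 ≤ n) (i j : Fin n) : ∃ k, k ≠ i ∧ k ≠ j := by
  obtain ⟨k, hk⟩ : ∃ k, k ∉ ({i, j} : Finset (Fin n)) := by
    by_contra hcon
    push Not at hcon
    have h1 : (Finset.univ : Finset (Fin n)) ⊆ {i, j} := fun k _ => hcon k
    have := (Finset.card_le_card h1).trans Finset.card_le_two
    simp at this; omega
  simp only [Finset.mem_insert, Finset.mem_singleton, not_or] at hk
  exact ⟨k, hk⟩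

structure SLrel {R : Type*} [Ring R] (X : Fin n → Fin n → R) : Prop where
  h1 : ∀ i j k, i ≠ j → j ≠ k → i ≠ k → ⁅X i j, X j k⁆ = X i k
  h2 : ∀ i j k l, i ≠ j → k ≠ l → j ≠ k → i ≠ l → ⁅X i j, X k l⁆ = 0

section
variable {R : Type*} [Ring R] [Algebra ℚ R] {X : Fin n → Fin n → R}

def Hh (X : Fin n → Fin n → R) (i j : Fin n) : R := if i = j then 0 else ⁅X i j, X j i⁆

lemma Hh_skew (i j : Fin n) : Hh X i j = - Hh X j i := by
  unfold Hh
  by_cases h : i = j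
  · simp [h]
  · simp [h, Ne.symm h]

lemma Hh_add (h : SLrel X) (i j k : Fin n) : Hh X i j + Hh X j k = Hh X i k := by
  by_cases hij : i = j
  · subst hij; simp [Hh]
  by_cases hjk : j = k
  · subst hjk; simp [Hh]
  by_cases hik : i = k
  · subst hik; rw [Hh_skew]; simp [Hh]
  simp only [Hh, hij, hjk, hik, if_false]
  have e1 : ⁅X i j, X k i⁆ = - X k j := by rw [← lie_skew, h.h1 k i j (Ne.symm hik) hij (Ne.symm hjk)]
  have e2 : ⁅X j k, X k i⁆ = X j i := h.h1 j k i hjk (Ne.symm hik) (Ne.symm hij)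
  rw [← h.h1 i j k hij hjk hik, lie_lie, e1, e2, lie_neg, sub_neg_eq_add]

def dl (a b : Fin n) : ℚ := if a = b then 1 else 0

lemma rev1 (h : SLrel X) {i j k : Fin n} (hij : i ≠ j) (hki : k ≠ i) (hkj : k ≠ j) : ⁅X i j, X k i⁆ = - X k j := by
  rw [← lie_skew, h.h1 k i j hki hij hkj]

lemma Hh_X (hn : 3 ≤ n) (h : SLrel X) (i j k l : Fin n) (hkl : k ≠ l) :
    ⁅Hh X i j, X k l⁆ = (dl i k - dl j k - dl i l + dl j l) • X k l := by
  by_cases hij : i = j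
  · subst hij; simp [Hh]
  have base : ∀ k l, k ≠ l → ¬ (k = i ∧ l = j) → ¬ (k = j ∧ l = i) → 
      ⁅Hh X i j, X k l⁆ = (dl i k - dl j k - dl i l + dl j l) • X k l := by
    intro k l hkl c1 c2
    have hji := Ne.symm hij
    simp only [Hh, hij, if_false]
    rw [lie_lie]
    by_cases hki : i = k
    · subst hki
      have hjl : j ≠ l := fun e => c1 ⟨rfl, e.symm⟩
      rw [h.h1 j i l hji hkl hjl, h.h1 i j l hij hjl hkl, h.h2 i j i l hij hkl hji hkl]
      simp [dl, hji, hkl, hjl]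
    by_cases hkj : j = k
    · subst hkj
      have hil : i ≠ l := fun e => c2 ⟨rfl, e.symm⟩
      rw [h.h2 j i j l hji hkl hij hkl, h.h1 i j l hij hkl hil, h.h1 j i l hji hil hkl]
      simp [dl, hij, hkl, hil]
    by_cases hli : i = l
    · subst hli
      rw [h.h2 j i k i hji hkl hki hji, rev1 h hij hkl (Ne.symm hkj), lie_neg, rev1 h hji (Ne.symm hkj) hkl]
      simp [dl, hji, Ne.symm hkl, hkj]
    by_cases hlj : j = l
    · subst hlj
      rw [h.h2 i j k j hij hkl hkj hij, rev1 h hji hkl (Ne.symm hki), lie_neg, rev1 h hij (Ne.symm hki) hkl]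
      simp [dl, hij, Ne.symm hkl, hki]
    rw [h.h2 i j k l hij hkl hkj hli, h.h2 j i k l hji hkl hki hlj]
    simp [dl, hki, hkj, hli, hlj]
  by_cases hc : (k = i ∧ l = j) ∨ (k = j ∧ l = i)
  · obtain ⟨m, hmi, hmj⟩ := third hn i j
    have hk : m ≠ k ∧ m ≠ l := by rcases hc with ⟨rfl, rfl⟩ | ⟨rfl, rfl⟩ <;> exact ⟨by assumption, by assumption⟩
    rw [← h.h1 k m l (Ne.symm hk.1) hk.2 hkl, leibniz_lie,
      base k m (Ne.symm hk.1) (by rintro ⟨_, rfl⟩; exact hmj rfl) (by rintro ⟨_, rfl⟩; exact hmi rfl),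
      base m l hk.2 (by rintro ⟨rfl, _⟩; exact hmi rfl) (by rintro ⟨rfl, _⟩; exact hmj rfl),
      smul_lie, lie_smul, ← add_smul]
    congr 1
    simp [dl, Ne.symm hmi, Ne.symm hmj]; ring
  · push Not at hc
    exact base k l hkl (fun e => hc.1 e.1 e.2) (fun e => hc.2 e.1 e.2)

noncomputable def YY (X : Fin n → Fin n → R) (i j : Fin n) : R :=
  if i = j then (n : ℚ)⁻¹ • ∑ m, Hh X i m else X i j

lemma YY_ne (i j : Fin n) (h : i ≠ j) : YY X i j = X i j := by simp [YY, h]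

lemma YY_H (hn : 3 ≤ n) (h : SLrel X) (i j : Fin n) : YY X i i - YY X j j = Hh X i j := by
  have hn0 : (n : ℚ) ≠ 0 := by positivity
  simp only [YY, if_true]
  rw [← smul_sub, ← Finset.sum_sub_distrib]
  have : ∀ m, Hh X i m - Hh X j m = Hh X i j := by
    intro m; rw [← Hh_add h i j m]; abel
  simp only [this, Finset.sum_const, Finset.card_univ, Fintype.card_fin]
  rw [← Nat.cast_smul_eq_nsmul ℚ, smul_smul, inv_mul_cancel₀ hn0, one_smul]

lemma YY_X (hn : 3 ≤ n) (h : SLrel X) (i k l : Fin n) (hkl : k ≠ l) :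
    ⁅YY X i i, X k l⁆ = (dl i k - dl i l) • X k l := by
  have hn0 : (n : ℚ) ≠ 0 := by positivity
  simp only [YY, if_true]
  rw [smul_lie, sum_lie]
  simp only [Hh_X hn h i _ k l hkl]
  rw [← Finset.sum_smul, smul_smul]
  congr 1
  simp only [Finset.sum_add_distrib, Finset.sum_sub_distrib, dl, Finset.sum_ite_eq', Finset.mem_univ, if_true,
    Finset.sum_const, Finset.card_univ, Fintype.card_fin, nsmul_eq_mul]
  field_simp; ring

lemma YY_gl (hn : 3 ≤ n) (h : SLrel X) : IsGl (YY X) := by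
  constructor
  · intro i j k l
    by_cases hij : i = j
    · subst hij
      by_cases hkl : k = l
      · subst hkl
        have hH : ∀ a b, ⁅YY X i i, Hh X a b⁆ = 0 := by
          intro a b
          by_cases hab : a = b
          · simp [Hh, hab]
          simp only [Hh, hab, if_false]
          rw [leibniz_lie, YY_X hn h i a b hab, YY_X hn h i b a (Ne.symm hab), smul_lie, lie_smul, ← add_smul]
          simp
        have : ⁅YY X i i, YY X k k⁆ = 0 := by
          conv_lhs => rw [YY.eq_1 X k k]
          simp only [if_true]
          rw [lie_smul, lie_sum]; simp [hH]
        rw [this]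
        by_cases hik : i = k
        · subst hik; simp
        · simp [hik]
      · rw [YY_ne k l hkl, YY_X hn h i k l hkl, sub_smul]
        congr 1
        · by_cases hik : i = k
          · subst hik; simp [dl, YY_ne _ _ hkl]
          · simp [dl, hik]
        · by_cases hil : i = l
          · subst hil; simp [dl, YY_ne _ _ hkl]
          · simp [dl, hil]
    · by_cases hkl : k = l
      · subst hkl
        rw [YY_ne i j hij, ← lie_skew, YY_X hn h k i j hij, ← neg_smul, neg_sub, sub_smul]
        congr 1
        · by_cases hjk : j = k
          · subst hjk; simp [dl, YY_ne _ _ hij]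
          · simp [dl, hjk, Ne.symm hjk]
        · by_cases hik : i = k
          · subst hik; simp [dl, YY_ne _ _ hij]
          · simp [dl, hik, Ne.symm hik]
      · rw [YY_ne i j hij, YY_ne k l hkl]
        by_cases hjk : j = k
        · subst hjk
          by_cases hil : i = l
          · subst hil
            simp only [if_true]
            rw [YY_H hn h]; simp [Hh, hij]
          · rw [h.h1 i j l hij hkl hil]; simp [hil, YY_ne _ _ hil]
        · by_cases hil : i = l
          · subst hil
            rw [rev1 h hij hkl (Ne.symm hjk)]; simp [hjk, YY_ne _ _ (Ne.symm hjk)]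
          · rw [h.h2 i j k l hij hkl hjk hil]; simp [hjk, hil]
  · simp only [YY, if_true]
    rw [← Finset.smul_sum]
    have : ∑ i, ∑ m, Hh X i m = - ∑ i, ∑ m, Hh X i m := by
      conv_lhs => rw [Finset.sum_comm]
      rw [← Finset.sum_neg_distrib]
      refine Finset.sum_congr rfl fun i _ => ?_
      rw [← Finset.sum_neg_distrib]
      exact Finset.sum_congr rfl fun m _ => Hh_skew _ _
    have h2 : (2 : ℚ) • ∑ i, ∑ m, Hh X i m = 0 := by
      rw [two_smul]; nth_rewrite 1 [this]; simp
    rw [(smul_eq_zero.1 h2).resolve_left (by norm_num), smul_zero]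
end

lemma sl_fixed (hn : 3 ≤ n) {E : Type*} [AddCommGroup E] [Module ℚ E] [FiniteDimensional ℚ E]
    {X : Fin n → Fin n → Module.End ℚ E} (h : SLrel X) (f : E →ₗ[ℚ] ℚ)
    (hf : ∀ i j, i ≠ j → ∀ v, f (X i j v) = 0) (e : E) :
    ∃ w, f w = f e ∧ ∀ i j, i ≠ j → X i j w = 0 := by
  have hH : ∀ i j v, f (Hh X i j v) = 0 := by
    intro i j v
    by_cases hij : i = j
    · simp [Hh, hij]
    · simp [Hh, hij, Ring.lie_def, hf i j hij, hf j i (Ne.symm hij)]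
  obtain ⟨w, hw, hw'⟩ := gl_fixed (YY_gl hn h) f (by
    intro i j v
    by_cases hij : i = j
    · simp [YY, hij, hH, LinearMap.sum_apply]
    · rw [YY_ne i j hij]; exact hf i j hij v) e
  exact ⟨w, hw, fun i j hij => by rw [← YY_ne (X := X) i j hij]; exact hw' i j hij⟩
end RP
end Part9

section Part10
namespace RP
set_option linter.unusedSectionVars false
open Module
attribute [local instance] LieRing.ofAssociativeRing
variable {n : ℕ} {E : Type*} [AddCommGroup E] [Module ℚ E] [FiniteDimensional ℚ E]

lemma log_ker {u L : End ℚ E} (hu : IsNilpotent (u - 1)) (hL : IsLog u L) (w : E) : L w = 0 ↔ u w = w := by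
  obtain ⟨L', hL', q, hq, rfl⟩ := exLog u hu
  rw [hL.unique hL']
  have hc : Commute (u - 1) q := hq.sub_left (Commute.one_left q)
  have hc2 : Commute (u - 1) (1 + (u - 1) * q) :=
    (Commute.one_right _).add_right ((Commute.refl _).mul_right hc)
  have hun : IsUnit (1 + (u - 1) * q) := by
    apply IsNilpotent.isUnit_one_add
    exact hc.isNilpotent_mul_right hu
  rw [hc2.eq, Module.End.mul_apply]
  obtain ⟨v, hv⟩ := hun
  rw [← hv]
  constructor
  · intro h
    have := congrArg (fun y => (v⁻¹ : (End ℚ E)ˣ).1 y) h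
    simp only [map_zero, ← Module.End.mul_apply] at this
    rw [← mul_assoc, Units.inv_mul, one_mul, LinearMap.sub_apply, sub_eq_zero] at this
    exact this
  · intro h
    rw [LinearMap.sub_apply, h]; simp

lemma unip (hn : 3 ≤ n) (ρ : S n →* End ℚ E) (i j : Fin n) (h : i ≠ j) :
    IsNilpotent (ρ (x h ((2 * (finrank ℚ E).factorial : ℕ) : ℤ)) - 1) := by
  obtain ⟨k, hki, hkj⟩ := third hn i j
  have hik := Ne.symm hki
  have key := qu (ρ (x hik 1)) (ρ (x hkj 1)) (ρ (x h 1)) (ρ (x hik 1)⁻¹) (ρ (x hkj 1)⁻¹)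
    (by rw [← map_mul, inv_mul_cancel, map_one]) (by rw [← map_mul, inv_mul_cancel, map_one])
    (by rw [← map_mul, x_rel hik hkj h]; simp)
    (by rw [← map_mul, ← map_mul, x_comm _ _ h.symm hik])
    (by rw [← map_mul, ← map_mul, x_comm _ _ hkj.symm h])
  have e : x h ((2 * (finrank ℚ E).factorial : ℕ) : ℤ) = (x h 1 ^ (finrank ℚ E).factorial) ^ 2 := by
    rw [← pow_mul, x_pow]; congr 1; push_cast; ring
  rw [e, map_pow, map_pow]
  generalize ρ (x h 1) ^ (finrank ℚ E).factorial = z at *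
  have : z ^ 2 - 1 = (z - 1) * (z + 1) := by noncomm_ring
  rw [this]
  apply Commute.isNilpotent_mul_right _ key
  exact ((Commute.refl z).add_right (Commute.one_right z)).sub_left (Commute.one_left _)

lemma sl_main (hn : 3 ≤ n) (ρ : S n →* End ℚ E) (f : E →ₗ[ℚ] ℚ) (hf : ∀ g v, f (ρ g v) = f v) (e : E) :
    ∃ w, f w = f e ∧ ∀ g, ρ g w = w := by
  obtain ⟨N, hNdef⟩ : ∃ N : ℕ, N = 2 * (finrank ℚ E).factorial := ⟨_, rfl⟩
  have hN : 2 ≤ N := by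
    have := Nat.factorial_pos (finrank ℚ E); omega
  have hun : ∀ i j (h : i ≠ j), IsNilpotent (ρ (x h (N : ℤ)) - 1) := by
    rw [hNdef]; exact unip hn ρ
  have hN0 : (N : ℚ) ≠ 0 := by positivity
  have hex : ∀ i j : Fin n, ∃ L, ∀ h : i ≠ j, IsLog (ρ (x h (N : ℤ))) L := by
    intro i j
    by_cases h : i = j
    · exact ⟨0, fun h' => absurd h h'⟩
    · obtain ⟨L, hL, -⟩ := exLog _ (hun i j h)
      exact ⟨L, fun _ => hL⟩
  choose L hL using hex
  let X : Fin n → Fin n → End ℚ E := fun i j => (N : ℚ)⁻¹ • L i j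
  have hX : SLrel X := by
    constructor
    · intro i j k hij hjk hik
      have hu := hL i j hij
      have hv := hL j k hjk
      have hw := hL i k hik
      have hrel := x_rel hij hjk hik (N : ℤ) (N : ℤ)
      have hpow : x hik ((N : ℤ) * N) = x hik (N : ℤ) ^ N := (x_pow hik _ _).symm
      have c1 : Commute (ρ (x hij (N : ℤ))) (ρ (x hik (N : ℤ))) := by
        rw [Commute, SemiconjBy, ← map_mul, ← map_mul, x_comm _ _ hij.symm hik]
      have c2 : Commute (ρ (x hik (N : ℤ))) (ρ (x hjk (N : ℤ))) := by
        rw [Commute, SemiconjBy, ← map_mul, ← map_mul, x_comm _ _ hjk.symm hik]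
      have iu : ρ (x hij (N : ℤ)) * ρ (x hij (N : ℤ))⁻¹ = 1 := by rw [← map_mul, mul_inv_cancel, map_one]
      have iu' : ρ (x hij (N : ℤ))⁻¹ * ρ (x hij (N : ℤ)) = 1 := by rw [← map_mul, inv_mul_cancel, map_one]
      have hc := hv.conj iu' iu
      have hm := (hw.pow N).mul hv (c2.pow_left N)
      have e1 : ρ (x hij (N : ℤ)) * ρ (x hjk (N : ℤ)) * ρ (x hij (N : ℤ))⁻¹ = 
          ρ (x hik (N : ℤ)) ^ N * ρ (x hjk (N : ℤ)) := by
        rw [← map_mul, hrel, hpow, map_mul, map_mul, map_pow, mul_assoc, mul_assoc, iu, mul_one]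
      rw [e1] at hc
      have e2 := hc.unique hm
      have e3 : ρ (x hij (N : ℤ)) * L j k = (L j k + N • L i k) * ρ (x hij (N : ℤ)) := by
        rw [add_comm, ← e2, mul_assoc, iu', mul_one]
      have e4 := hu.brk e3 ((hw.commute c1.symm).symm.smul_right N)
      simp only [X]
      rw [smul_lie, lie_smul, Ring.lie_def, e4, ← Nat.cast_smul_eq_nsmul ℚ, smul_smul, smul_smul]
      congr 1
      field_simp
    · intro i j k l hij hkl hjk hil
      have c1 : Commute (ρ (x hij (N : ℤ))) (ρ (x hkl (N : ℤ))) := by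
        rw [Commute, SemiconjBy, ← map_mul, ← map_mul, x_comm _ _ hjk hil]
      have c2 := ((hL k l hkl).commute ((hL i j hij).commute c1).symm)
      simp only [X]
      rw [smul_lie, lie_smul, Ring.lie_def, c2.eq, sub_self]; simp
  have hfX : ∀ i j, i ≠ j → ∀ v, f (X i j v) = 0 := by
    intro i j h v
    obtain ⟨L', hL', q, -, hq⟩ := exLog _ (hun i j h)
    simp only [X]
    rw [(hL i j h).unique hL', hq, LinearMap.smul_apply, map_smul, Module.End.mul_apply, LinearMap.sub_apply,
      map_sub, hf]
    simp
  have hXk : ∀ i j (h : i ≠ j) w, X i j w = 0 ↔ ρ (x h (N : ℤ)) w = w := by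
    intro i j h w
    rw [← log_ker (hun i j h) (hL i j h)]
    simp [X, hN0]
  obtain ⟨w0, hw0, hw0'⟩ := sl_fixed hn hX f hfX e
  let W : Set E := fun w => ∀ i j (h : i ≠ j), ρ (x h (N : ℤ)) w = w
  have hw0W : w0 ∈ W := fun i j h => (hXk i j h w0).1 (hw0' i j h)
  have hWz : ∀ w ∈ W, ∀ i j (h : i ≠ j) (m : ℤ), ρ (x h (m * N)) w = w := by
    intro w hw i j h m
    let St : Subgroup (S n) :=
      { carrier := fun g => ρ g w = w
        one_mem' := by change ρ 1 w = w; simp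
        mul_mem' := by
          intro a b (ha : ρ a w = w) (hb : ρ b w = w)
          change ρ (a * b) w = w
          rw [map_mul, Module.End.mul_apply, hb, ha]
        inv_mem' := by
          intro a (ha : ρ a w = w)
          change ρ a⁻¹ w = w
          nth_rewrite 1 [← ha]
          rw [← Module.End.mul_apply, ← map_mul, inv_mul_cancel, map_one]; rfl }
    have h1 : x h (N : ℤ) ∈ St := hw i j h
    have h2 := St.zpow_mem h1 m
    rw [x_zpow] at h2
    exact h2
  have ap : ∀ (a b : S n) (w : E), ρ a (ρ b w) = ρ (a * b) w := by
    intro a b w; rw [map_mul]; rfl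
  have hst : ∀ k l (h : k ≠ l) (c : ℤ), ∀ w ∈ W, ρ (x h c) w ∈ W := by
    intro k l hkl c w hw
    have main : ∀ i j (h : i ≠ j), ¬ (i = l ∧ j = k) → ρ (x h (N : ℤ)) (ρ (x hkl c) w) = ρ (x hkl c) w := by
      intro i j hij hne
      by_cases hjk : j = k
      · subst hjk
        have hil : i ≠ l := fun e => hne ⟨e, rfl⟩
        rw [ap, x_rel hij hkl hil, ← ap, ← ap, hw i j hij, ap, x_comm _ _ (Ne.symm hkl) hil, ← ap,
          mul_comm, hWz w hw]
      · by_cases hil : i = l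
        · subst hil
          have hkj : k ≠ j := Ne.symm hjk
          have h1 := x_rel hkl hij hkj c (N : ℤ)
          have h2 : x hij (N : ℤ) * x hkl c = x hkj ((-c) * N) * (x hkl c * x hij (N : ℤ)) := by
            rw [h1, neg_mul, ← x_inv, inv_mul_cancel_left]
          rw [ap, h2, ← ap, ← ap, hw i j hij, ap, x_comm _ _ hjk hkl, ← ap, hWz w hw]
        · rw [ap, x_comm _ _ hjk hil, ← ap, hw i j hij]
    intro i j hij
    by_cases hc : i = l ∧ j = k
    · obtain ⟨m, hmi, hmj⟩ := third hn i j
      rw [← hXk, ← hX.h1 i m j hmi.symm hmj hij, Ring.lie_def, LinearMap.sub_apply, Module.End.mul_apply,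
        Module.End.mul_apply]
      rw [(hXk m j hmj _).2 (main m j hmj (fun e => hmi (e.1.trans hc.1.symm))),
        (hXk i m hmi.symm _).2 (main i m hmi.symm (fun e => hmj (e.2.trans hc.2.symm)))]
      simp
    · exact main i j hij hc
  have hstab : ∀ g : S n, (∀ w ∈ W, ρ g w ∈ W) ∧ (∀ w ∈ W, ρ g⁻¹ w ∈ W) := by
    intro g
    have hg : g ∈ El n := by rw [El_eq_top]; trivial
    rw [El] at hg
    induction hg using Subgroup.closure_induction with
    | mem y hy =>
      obtain ⟨i, j, h, c, rfl⟩ := hy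
      exact ⟨hst i j h c, by rw [x_inv]; exact hst i j h _⟩
    | one => simp
    | mul a b _ _ ha hb =>
      refine ⟨fun w hw => ?_, fun w hw => ?_⟩
      · rw [← ap]; exact ha.1 _ (hb.1 _ hw)
      · rw [_root_.mul_inv_rev, ← ap]; exact hb.2 _ (ha.2 _ hw)
    | inv a _ ha => exact ⟨ha.2, by rw [inv_inv]; exact ha.1⟩
  let K : Subgroup (S n) :=
      { carrier := fun g => ∀ w ∈ W, ρ g w = w
        one_mem' := by intro w _; simp
        mul_mem' := by
          intro a b ha hb w hw
          rw [← ap, hb w hw, ha w hw]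
        inv_mem' := by
          intro a ha w hw
          nth_rewrite 1 [← ha w hw]
          rw [ap, inv_mul_cancel, map_one]; rfl }
  have hKn : K.Normal := by
    constructor
    intro k hk g w hw
    have hk' : ∀ w ∈ W, ρ k w = w := hk
    rw [← ap, ← ap, hk' _ ((hstab g).2 w hw), ap, mul_inv_cancel, map_one]; rfl
  have hKf : K.FiniteIndex := finite_quot hN K (fun i j h w hw => hw i j h) hn
  have : Finite (S n ⧸ K) := inferInstance
  have : Fintype (S n ⧸ K) := Fintype.ofFinite _
  let F : S n ⧸ K → E := fun q => ρ q.out w0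
  have hF : ∀ (g : S n) q, ρ g (F q) = F (g • q) := by
    intro g q
    simp only [F]
    have h1 : ((g * q.out)⁻¹ * (g • q).out) ∈ K := by
      rw [← QuotientGroup.eq, QuotientGroup.out_eq', ← smul_eq_mul, ← MulAction.Quotient.smul_mk,
        QuotientGroup.out_eq']
    have h2 : ρ ((g * q.out)⁻¹ * (g • q).out) w0 = w0 := h1 w0 hw0W
    have h3 := congrArg (ρ (g * q.out)) h2
    rw [ap, mul_inv_cancel_left] at h3
    rw [ap, h3]
  have hc0 : ((Fintype.card (S n ⧸ K) : ℕ) : ℚ) ≠ 0 := by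
    exact_mod_cast Fintype.card_ne_zero
  refine ⟨((Fintype.card (S n ⧸ K) : ℕ) : ℚ)⁻¹ • ∑ q, F q, ?_, ?_⟩
  · rw [map_smul, map_sum]
    simp only [F, hf, hw0, Finset.sum_const, Finset.card_univ, nsmul_eq_mul, smul_eq_mul]
    field_simp
  · intro g
    rw [map_smul, map_sum]
    simp only [hF]
    congr 1
    exact Equiv.sum_comp (MulAction.toPerm g) F
end RP
end Part10

section Part11
namespace RP
open Module Matrix
variable {n : ℕ}

lemma exD (hn : 3 ≤ n) : ∃ d : GL (Fin n) ℤ, d * d = 1 ∧ Matrix.GeneralLinearGroup.det d = -1 := by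
  let a : Fin n := ⟨0, by omega⟩
  let D : Fin n → ℤ := Function.update 1 a (-1)
  have hD : Matrix.diagonal D * Matrix.diagonal D = 1 := by
    rw [Matrix.diagonal_mul_diagonal, ← Matrix.diagonal_one]
    congr 1
    ext i
    by_cases h : i = a
    · subst h; simp [D]
    · simp [D, h]
  refine ⟨⟨Matrix.diagonal D, Matrix.diagonal D, hD, hD⟩, Units.ext hD, ?_⟩
  ext
  simp [Matrix.GeneralLinearGroup.det, D, Matrix.det_diagonal, Finset.prod_update_of_mem]

lemma gl_main (hn : 3 ≤ n) {V : Type*} [AddCommGroup V] [Module ℚ V] [FiniteDimensional ℚ V]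
    (ρ : GL (Fin n) ℤ →* End ℚ V) (c : GL (Fin n) ℤ → V) (hc : ∀ g h, c (g * h) = ρ g (c h) + c g) :
    ∃ v, ∀ g, ρ g v - v = c g := by
  have c1 : c 1 = 0 := by simpa using hc 1 1
  let σ : GL (Fin n) ℤ →* End ℚ (V × ℚ) :=
    { toFun := fun g => LinearMap.prod ((ρ g).comp (LinearMap.fst ℚ V ℚ) + (LinearMap.snd ℚ V ℚ).smulRight (c g))
        (LinearMap.snd ℚ V ℚ)
      map_one' := by
        refine LinearMap.ext fun p => ?_
        simp [c1]
      map_mul' := by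
        intro g h
        refine LinearMap.ext fun p => ?_
        simp [hc]; abel }
  have hσ : ∀ g p, σ g p = (ρ g p.1 + p.2 • c g, p.2) := fun g p => rfl
  obtain ⟨w, hw, hfix⟩ := sl_main hn (σ.comp Matrix.SpecialLinearGroup.toGL) (LinearMap.snd ℚ V ℚ)
    (fun g v => rfl) (0, 1)
  have hw : w.2 = 1 := hw
  have ap : ∀ a b p, σ a (σ b p) = σ (a * b) p := by intro a b p; rw [map_mul]; rfl
  have hdet : ∀ g : GL (Fin n) ℤ, Matrix.GeneralLinearGroup.det g = 1 → σ g w = w := by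
    intro g hg
    have hg' : g.1.det = 1 := congrArg Units.val hg
    have e : Matrix.SpecialLinearGroup.toGL (⟨g.1, hg'⟩ : S n) = g := Units.ext rfl
    have h2 : σ (Matrix.SpecialLinearGroup.toGL (⟨g.1, hg'⟩ : S n)) w = w := hfix ⟨g.1, hg'⟩
    rw [e] at h2
    exact h2
  obtain ⟨d, hd, hdd⟩ := exD hn
  let w' := (2⁻¹ : ℚ) • (w + σ d w)
  have hw'2 : w'.2 = 1 := by
    simp [w', hσ, hw]; norm_num
  have hw' : ∀ g, σ g w' = w' := by
    intro g
    have key : σ g w + σ g (σ d w) = w + σ d w := by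
      rcases Int.units_eq_one_or (Matrix.GeneralLinearGroup.det g) with h | h
      · rw [hdet g h, ap]
        have e : g * d = d * (d * g * d) := by
          rw [← mul_assoc, ← mul_assoc, hd, one_mul]
        rw [e, ← ap, hdet (d * g * d) (by simp [h, hdd])]
      · have e : g = d * (d * g) := by rw [← mul_assoc, hd, one_mul]
        rw [ap, hdet (g * d) (by simp [h, hdd])]
        have : σ g w = σ d w := by
          conv_lhs => rw [e]
          rw [← ap, hdet (d * g) (by simp [h, hdd])]
        rw [this, add_comm]
    simp only [w']
    rw [map_smul, map_add, key]
  refine ⟨-w'.1, fun g => ?_⟩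
  have := congrArg Prod.fst (hw' g)
  rw [hσ, hw'2] at this
  simp only [one_smul] at this
  rw [map_neg]
  nth_rewrite 2 [← this]
  abel
end RP
end Part11

/-- For `g ≥ 3`, the general linear group `GL_g(ℤ)` is rationally perfect. -/
theorem statement_8 (g : ℕ) (hg : 3 ≤ g) :
    RationallyPerfect (GL (Fin g) ℤ) := by
  intro V _ _ _ ρ
  refine ⟨fun a b => ?_⟩
  have key : ∀ a : groupCohomology.H1 (Rep.of ρ), a = 0 := by
    intro a
    induction a using groupCohomology.H1_induction_on with
    | h y =>
      rw [groupCohomology.H1π_eq_zero_iff]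
      obtain ⟨v, hv⟩ := RP.gl_main hg ρ y (fun g h => (groupCohomology.mem_cocycles₁_iff _).1 y.2 g h)
      exact ⟨v, funext hv⟩
  rw [key a, key b]
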